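/- arXiv:2510.24387 — 3 statements merged into one kernel-verified Lean document; each statement's English description precedes it below -/
import Mathlib

section
/- Let n, d be integers with 2 ≤ d ≤ n−1. The best meeting time of the balanced lever L_{n,d} is T_bestmeet(L_{n,d}) = (d³ − d)/(6(n−1)) + 1/2 if d is odd, and T_bestmeet(L_{n,d}) = (d³ − 4d)/(6(n−1)) + 1/2 if d is even. -/
open Finset
open scoped Classical

/-- The degree of vertex `v` in `G`. -/
noncomputable def gdeg {V : Type*} [Fintype V] (G : SimpleGraph V) (v : V) : ℕ :=
  (Finset.univ.filter fun u => G.Adj v u).card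

/-- `ℓ(u,v;w) = (d(u,w) + d(v,w) - d(u,v))/2`. -/
noncomputable def ell {V : Type*} (G : SimpleGraph V) (u v w : V) : ℚ :=
  ((G.dist u w : ℚ) + (G.dist v w : ℚ) - (G.dist u v : ℚ)) / 2

/-- The hitting time `H(u,w) = Σ_v ℓ(u,v;w)·deg(v)` (valid formula on trees). -/
noncomputable def hitTime {V : Type*} [Fintype V] (G : SimpleGraph V) (u w : V) : ℚ :=
  ∑ v, ell G u v w * (gdeg G v : ℚ)

/-- The joining time to `w`: `J(w) = Σ_u deg(u)·H(u,w)`. -/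
noncomputable def joinTime {V : Type*} [Fintype V] (G : SimpleGraph V) (w : V) : ℚ :=
  ∑ u, (gdeg G u : ℚ) * hitTime G u w

/-- `J_min(G) = min_{w} J(w)` (junk value 0 on the empty graph). -/
noncomputable def Jmin {V : Type*} [Fintype V] (G : SimpleGraph V) : ℚ :=
  if h : Nonempty V then
    haveI := h
    Finset.univ.inf' Finset.univ_nonempty (joinTime G)
  else 0

/-- The best meeting time `T_bestmeet(G) = J_min(G)/(2(n-1))`. -/
noncomputable def bestMeet {V : Type*} [Fintype V] (G : SimpleGraph V) : ℚ :=
  Jmin G / (2 * ((Fintype.card V : ℚ) - 1))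

/-- The diameter of `G` : the maximum of `d(u,v)` over pairs of vertices. -/
noncomputable def gdiam {V : Type*} [Fintype V] (G : SimpleGraph V) : ℕ :=
  Finset.univ.sup fun p : V × V => G.dist p.1 p.2

/-- The lever of order `n` and diameter `d` with fulcrum `v_k`: a path `v_0, …, v_d`
(on vertices `0, …, d`) together with `n - d - 1` pendant leaves (vertices `d+1, …, n-1`)
all adjacent to `v_k`. -/
def leverGraph (n d k : ℕ) : SimpleGraph (Fin n) :=
  SimpleGraph.fromRel fun i j =>
    (i.val + 1 = j.val ∧ j.val ≤ d) ∨ (i.val = k ∧ d < j.val)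

/-- The balanced lever `L_{n,d}`: the lever with fulcrum `v_{⌊d/2⌋}`. -/
def balancedLever (n d : ℕ) : SimpleGraph (Fin n) :=
  leverGraph n d (d / 2)

/-- The double broom of order `n`, diameter `d`, with `a` extra pendant leaves adjacent
to `v_1` and `n - d - 1 - a` extra pendant leaves adjacent to `v_{d-1}`.  The path
`v_0, …, v_d` sits on vertices `0, …, d`, the leaves at `v_1` are `d+1, …, d+a`, and the
leaves at `v_{d-1}` are `d+a+1, …, n-1`. -/
def doubleBroom (n d a : ℕ) : SimpleGraph (Fin n) :=
  SimpleGraph.fromRel fun i j =>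
    (i.val + 1 = j.val ∧ j.val ≤ d) ∨
    (i.val = 1 ∧ d < j.val ∧ j.val ≤ d + a) ∨
    (i.val = d - 1 ∧ d + a < j.val)

/-- The balanced double broom `D_{n,d}`, with `⌊(n-d-1)/2⌋` leaves at `v_1`
and `⌈(n-d-1)/2⌉` leaves at `v_{d-1}`. -/
def balancedDoubleBroom (n d : ℕ) : SimpleGraph (Fin n) :=
  doubleBroom n d ((n - d - 1) / 2)

/-- The broom `B_{n,d}`: a path `v_0, …, v_d` with `n - d - 1` pendant leaves adjacent to `v_1`. -/
def broomGraph (n d : ℕ) : SimpleGraph (Fin n) :=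
  doubleBroom n d (n - d - 1)

/-- The star `S_n = K_{1,n-1}` with center `0`. -/
def starGraph (n : ℕ) : SimpleGraph (Fin n) :=
  SimpleGraph.fromRel fun i _ => i.val = 0

/-- A presentation of the tree `G` rooted at `r`: `par` sends a vertex other than `r` to its
parent, and `T x u` says that `u` lies in the branch below the edge joining `x ≠ r` to `par x`. -/
structure IsRooted {V : Type*} (G : SimpleGraph V) (r : V) (par : V → V) (T : V → V → Prop) :
    Prop where
  adj_iff : ∀ u v, G.Adj u v ↔ (u ≠ r ∧ par u = v) ∨ (v ≠ r ∧ par v = u)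
  not_root : ∀ x, ¬ T x r
  not_root_left : ∀ u, ¬ T r u
  iff_parent : ∀ x c, c ≠ r → (T x c ↔ x = c ∨ T x (par c))
  not_parent : ∀ c, c ≠ r → ¬ T c (par c)
  antisymm : ∀ u v, T u v → T v u → u = v

/-- The vertices whose branch separates `u` from `v`. -/
noncomputable def separators {V : Type*} [Fintype V] (T : V → V → Prop) (u v : V) : Finset V :=
  univ.filter fun x => ¬ (T x u ↔ T x v)

theorem mem_separators {V : Type*} [Fintype V] {T : V → V → Prop} {u v x : V} :
    x ∈ separators T u v ↔ ¬ (T x u ↔ T x v) := by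
  simp [separators]

theorem separators_comm {V : Type*} [Fintype V] (T : V → V → Prop) (u v : V) :
    separators T u v = separators T v u := by
  ext x
  simp only [mem_separators]
  tauto

/-- The indicator function of the branch at `x`. -/
noncomputable def branchInd {V : Type*} (T : V → V → Prop) (x u : V) : ℚ :=
  if T x u then 1 else 0

/-- The number of vertices of the branch at `x`. -/
noncomputable def branchCard {V : Type*} [Fintype V] (T : V → V → Prop) (x : V) : ℕ :=
  (univ.filter fun u => T x u).card

theorem sum_branchInd {V : Type*} [Fintype V] (T : V → V → Prop) (x : V) :
    ∑ u, branchInd T x u = branchCard T x := by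
  simp [branchInd, branchCard]

namespace IsRooted

variable {V : Type*} {G : SimpleGraph V} {r : V} {par : V → V} {T : V → V → Prop}

theorem exists_separating (h : IsRooted G r par T) {u v : V} (huv : u ≠ v) :
    (u ≠ r ∧ ¬ T u v) ∨ (v ≠ r ∧ ¬ T v u) := by
  by_cases hu : u = r
  · subst hu
    exact Or.inr ⟨huv.symm, h.not_root v⟩
  by_cases hv : v = r
  · subst hv
    exact Or.inl ⟨huv, h.not_root u⟩
  have := h.antisymm u v
  tauto

variable [Fintype V]

theorem separators_eq_insert (h : IsRooted G r par T) {u v : V} (hu : u ≠ r) (huv : ¬ T u v) :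
    separators T u v = insert u (separators T (par u) v) := by
  ext x
  have h1 := h.iff_parent x u hu
  have h2 := h.not_parent u hu
  simp only [mem_separators, mem_insert]
  by_cases hx : x = u
  · subst hx
    tauto
  · tauto

theorem card_separators_parent (h : IsRooted G r par T) {u v : V} (hu : u ≠ r)
    (huv : ¬ T u v) :
    (separators T u v).card = (separators T (par u) v).card + 1 := by
  rw [h.separators_eq_insert hu huv, card_insert_of_notMem]
  have h2 := h.not_parent u hu
  simp only [mem_separators]
  tauto

theorem exists_walk (h : IsRooted G r par T) (m : ℕ) :
    ∀ u v, (separators T u v).card = m → ∃ p : G.Walk u v, p.length = m := by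
  induction m with
  | zero =>
    intro u v huv
    by_cases e : u = v
    · subst e
      exact ⟨.nil, rfl⟩
    · rcases h.exists_separating e with ⟨h1, h2⟩ | ⟨h1, h2⟩
      · rw [h.card_separators_parent h1 h2] at huv
        omega
      · rw [separators_comm, h.card_separators_parent h1 h2] at huv
        omega
  | succ m ih =>
    intro u v huv
    by_cases e : u = v
    · subst e
      simp [separators] at huv
    · rcases h.exists_separating e with ⟨h1, h2⟩ | ⟨h1, h2⟩
      · rw [h.card_separators_parent h1 h2] at huv
        obtain ⟨p, hp⟩ := ih (par u) v (by omega)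
        exact ⟨.cons ((h.adj_iff _ _).2 (Or.inl ⟨h1, rfl⟩)) p, by simp [hp]⟩
      · rw [separators_comm, h.card_separators_parent h1 h2, separators_comm] at huv
        obtain ⟨p, hp⟩ := ih u (par v) (by omega)
        exact ⟨p.concat ((h.adj_iff _ _).2 (Or.inr ⟨h1, rfl⟩)), by simp [hp]⟩

theorem card_separators_le_of_adj (h : IsRooted G r par T) {u u' : V} (v : V)
    (ha : G.Adj u u') : (separators T u v).card ≤ (separators T u' v).card + 1 := by
  obtain ⟨c, hc⟩ : ∃ c, ∀ x, x ≠ c → (T x u ↔ T x u') := by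
    rcases (h.adj_iff _ _).1 ha with ⟨h1, rfl⟩ | ⟨h1, rfl⟩
    · exact ⟨u, fun x hx => by simp [h.iff_parent x u h1, hx]⟩
    · exact ⟨u', fun x hx => by simp [h.iff_parent x u' h1, hx]⟩
  refine (card_le_card ?_).trans (card_insert_le c _)
  intro x hx
  rw [mem_separators] at hx
  rw [mem_insert, mem_separators]
  by_cases e : x = c
  · exact Or.inl e
  · rw [hc x e] at hx
    exact Or.inr hx

theorem card_separators_le_length (h : IsRooted G r par T) {u v : V} (p : G.Walk u v) :
    (separators T u v).card ≤ p.length := by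
  induction p with
  | nil => simp [separators]
  | cons ha p ih =>
    rw [SimpleGraph.Walk.length_cons]
    exact (h.card_separators_le_of_adj _ ha).trans (by omega)

theorem dist_eq_card (h : IsRooted G r par T) (u v : V) :
    G.dist u v = (separators T u v).card := by
  obtain ⟨p, hp⟩ := h.exists_walk _ u v rfl
  refine le_antisymm (hp ▸ SimpleGraph.dist_le p) ?_
  obtain ⟨q, hq⟩ := p.reachable.exists_walk_length_eq_dist
  exact hq ▸ h.card_separators_le_length q

theorem dist_eq_sum (h : IsRooted G r par T) (u v : V) :
    (G.dist u v : ℚ) = ∑ x, (branchInd T x u - branchInd T x v) ^ 2 := by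
  rw [h.dist_eq_card, separators, card_filter]
  push_cast
  refine sum_congr rfl fun x _ => ?_
  unfold branchInd
  by_cases h1 : T x u <;> by_cases h2 : T x v <;> simp [h1, h2]

theorem ell_eq_sum (h : IsRooted G r par T) (u v w : V) :
    ell G u v w =
      ∑ x, (branchInd T x u - branchInd T x w) * (branchInd T x v - branchInd T x w) := by
  rw [ell, h.dist_eq_sum, h.dist_eq_sum, h.dist_eq_sum, ← sum_add_distrib, ← sum_sub_distrib,
    sum_div]
  exact sum_congr rfl fun x _ => by ring

theorem joinTime_eq_sum (h : IsRooted G r par T) (w : V) :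
    joinTime G w =
      ∑ x, (∑ u, (gdeg G u : ℚ) * (branchInd T x u - branchInd T x w)) ^ 2 := by
  simp only [joinTime, hitTime, h.ell_eq_sum, sq, mul_sum, sum_mul]
  rw [sum_congr rfl fun u _ => sum_comm, sum_comm]
  exact sum_congr rfl fun x _ => sum_congr rfl fun u _ => sum_congr rfl fun v _ => by ring

theorem sum_degree_mul (h : IsRooted G r par T) (f : V → ℚ) :
    ∑ u, (gdeg G u : ℚ) * f u = ∑ c ∈ univ.erase r, (f c + f (par c)) := by
  have hadj : ∀ u v, (if G.Adj u v then (1 : ℚ) else 0) =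
      (if u ≠ r ∧ par u = v then 1 else 0) + (if v ≠ r ∧ par v = u then 1 else 0) := by
    intro u v
    by_cases h1 : u ≠ r ∧ par u = v <;> by_cases h2 : v ≠ r ∧ par v = u
    · exfalso
      have h3 := h.not_parent v h2.1
      have h4 := h.iff_parent v u h1.1
      have h5 := h.iff_parent v v h2.1
      rw [h1.2] at h4
      rw [h2.2] at h3
      tauto
    all_goals simp [h.adj_iff, h1, h2]
  have hdeg : ∀ u, (gdeg G u : ℚ) * f u = ∑ v, (if G.Adj u v then (1 : ℚ) else 0) * f u := by
    intro u
    rw [← sum_mul, gdeg, card_filter]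
    push_cast
    rfl
  have hind : ∀ (g : V → ℚ),
      ∑ c ∈ univ.erase r, g c = ∑ c, if c ≠ r then g c else 0 := by
    intro g
    rw [← sum_filter]
    refine sum_congr ?_ fun _ _ => rfl
    ext
    simp
  simp only [hdeg, hadj, add_mul, sum_add_distrib]
  rw [hind, hind]
  refine congrArg₂ (· + ·) ?_ ?_
  · refine sum_congr rfl fun u _ => ?_
    by_cases hu : u = r <;> simp [hu]
  · rw [sum_comm]
    refine sum_congr rfl fun u _ => ?_
    by_cases hu : u = r <;> simp [hu]

theorem sum_degree (h : IsRooted G r par T) :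
    ∑ u, (gdeg G u : ℚ) = 2 * ((Fintype.card V : ℚ) - 1) := by
  have := h.sum_degree_mul fun _ => 1
  simp only [mul_one] at this
  have hpos : 1 ≤ Fintype.card V := Fintype.card_pos_iff.2 ⟨r⟩
  rw [this, sum_const, card_erase_of_mem (mem_univ r), card_univ, nsmul_eq_mul,
    Nat.cast_sub hpos]
  push_cast
  ring

theorem sum_degree_branch (h : IsRooted G r par T) {x : V} (hx : x ≠ r) :
    ∑ u, (gdeg G u : ℚ) * branchInd T x u = 2 * (branchCard T x : ℚ) - 1 := by
  have hpar : ∀ c ∈ univ.erase r, branchInd T x c + branchInd T x (par c) =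
      2 * branchInd T x c - if c = x then 1 else 0 := by
    intro c hc
    have hc' := ne_of_mem_erase hc
    have h1 := h.iff_parent x c hc'
    by_cases e : c = x
    · subst e
      have h2 := h.not_parent c hc'
      have h3 : T c c := h1.2 (Or.inl rfl)
      simp [branchInd, h2, h3]
      norm_num
    · have h2 : T x c ↔ T x (par c) := by
        rw [h1]
        exact or_iff_right fun hxc => e hxc.symm
      by_cases h3 : T x (par c) <;> simp [branchInd, h2, h3, e]
      norm_num
  rw [h.sum_degree_mul, sum_congr rfl hpar, sum_sub_distrib, ← mul_sum, ← sum_branchInd,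
    sum_ite_eq', if_pos (mem_erase.2 ⟨hx, mem_univ x⟩), sum_erase]
  simp [branchInd, h.not_root]

theorem joinTime_eq (h : IsRooted G r par T) (w : V) :
    joinTime G w = ∑ x ∈ univ.erase r, (2 * (branchCard T x : ℚ) - 1 -
      2 * ((Fintype.card V : ℚ) - 1) * branchInd T x w) ^ 2 := by
  rw [h.joinTime_eq_sum, ← add_sum_erase _ _ (mem_univ r)]
  have hr : ∀ u, branchInd T r u = 0 := fun u => by simp [branchInd, h.not_root_left]
  simp only [hr, sub_self, mul_zero, sum_const_zero]
  rw [zero_pow two_ne_zero, zero_add]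
  refine sum_congr rfl fun x hx => ?_
  simp only [mul_sub, sum_sub_distrib, ← sum_mul]
  rw [h.sum_degree_branch (ne_of_mem_erase hx), h.sum_degree]
  ring

/-- If no branch contains more than half of the vertices, the root minimises the joining time. -/
theorem Jmin_eq (h : IsRooted G r par T)
    (hT : ∀ x, x ≠ r → 2 * branchCard T x ≤ Fintype.card V) :
    Jmin G = ∑ x ∈ univ.erase r, (2 * (branchCard T x : ℚ) - 1) ^ 2 := by
  have hne : Nonempty V := ⟨r⟩
  have hr : joinTime G r = ∑ x ∈ univ.erase r, (2 * (branchCard T x : ℚ) - 1) ^ 2 := by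
    rw [h.joinTime_eq]
    exact sum_congr rfl fun x _ => by simp [branchInd, h.not_root]
  rw [Jmin, dif_pos hne, ← hr]
  refine le_antisymm (inf'_le _ (mem_univ r)) (le_inf' _ _ fun w _ => ?_)
  rw [hr, h.joinTime_eq]
  refine sum_le_sum fun x hx => ?_
  have h1 : 2 * (branchCard T x : ℚ) ≤ Fintype.card V := by
    exact_mod_cast hT x (ne_of_mem_erase hx)
  have h2 : (1 : ℚ) ≤ Fintype.card V := by
    exact_mod_cast Fintype.card_pos_iff.2 hne
  unfold branchInd
  split_ifs
  · nlinarith [mul_nonneg (sub_nonneg.2 h1) (sub_nonneg.2 h2)]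
  · simp

end IsRooted

/-- The parent of a vertex of the lever, rooted at its fulcrum. -/
def leverParent {n d k : ℕ} (hk : k < d) (hd : d < n) (i : Fin n) : Fin n :=
  ⟨if i.val < k then i.val + 1 else if i.val ≤ d then i.val - 1 else k, by
    have := i.isLt
    split_ifs <;> omega⟩

/-- The branch relation of the lever, rooted at its fulcrum. -/
def leverBranch {n : ℕ} (d k : ℕ) (x u : Fin n) : Prop :=
  (x.val < k ∧ u.val ≤ x.val) ∨ (k < x.val ∧ x.val ≤ u.val ∧ u.val ≤ d) ∨
    (d < x.val ∧ u.val = x.val)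

theorem isRooted_leverGraph {n d k : ℕ} (hk : k < d) (hd : d < n) :
    IsRooted (leverGraph n d k) ⟨k, hk.trans hd⟩ (leverParent hk hd) (leverBranch d k) where
  adj_iff u v := by
    simp only [leverGraph, SimpleGraph.fromRel_adj, leverParent, ne_eq, Fin.ext_iff]
    split_ifs <;> omega
  not_root x := by
    simp only [leverBranch]
    omega
  not_root_left u := by
    simp only [leverBranch]
    omega
  iff_parent x c hc := by
    simp only [leverBranch, leverParent, ne_eq, Fin.ext_iff] at hc ⊢
    split_ifs <;> omega
  not_parent c hc := by
    simp only [leverBranch, leverParent, ne_eq, Fin.ext_iff] at hc ⊢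
    split_ifs <;> omega
  antisymm u v huv hvu := by
    simp only [leverBranch, Fin.ext_iff] at huv hvu ⊢
    omega

theorem branchCard_lever {n d k : ℕ} (hk : k < d) (hd : d < n) (x : Fin n) (hx : x.val ≠ k) :
    branchCard (leverBranch d k) x =
      if x.val < k then x.val + 1 else if x.val ≤ d then d - x.val + 1 else 1 := by
  rw [branchCard]
  split_ifs with h1 h2
  · have : (univ.filter fun u => leverBranch d k x u) = Iic x := by
      ext u
      rw [mem_filter_univ]
      simp only [leverBranch, mem_Iic, Fin.le_def]
      omega
    rw [this, Fin.card_Iic]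
  · have : (univ.filter fun u => leverBranch d k x u) = Icc x ⟨d, hd⟩ := by
      ext u
      rw [mem_filter_univ]
      simp only [leverBranch, mem_Icc, Fin.le_def]
      omega
    rw [this, Fin.card_Icc]
    simp only
    omega
  · have : (univ.filter fun u => leverBranch d k x u) = {x} := by
      ext u
      rw [mem_filter_univ]
      simp only [leverBranch, mem_singleton, Fin.ext_iff]
      omega
    rw [this, card_singleton]

theorem sum_range_odd_sq (m : ℕ) :
    ∑ i ∈ range m, (2 * (i : ℚ) + 1) ^ 2 = (m : ℚ) * (4 * (m : ℚ) ^ 2 - 1) / 3 := by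
  induction m with
  | zero => simp
  | succ m ih =>
    rw [sum_range_succ, ih]
    push_cast
    ring

/-- The joining time of the lever to its fulcrum, with arms of lengths `k` and `b` and
`m` further leaves. -/
theorem sum_branchCard_lever {n k b m : ℕ} (hb : 0 < b) (hn : n = k + b + 1 + m)
    (hkn : k < n) :
    ∑ x ∈ univ.erase (⟨k, hkn⟩ : Fin n), (2 * (branchCard (leverBranch (k + b) k) x : ℚ) - 1) ^ 2 =
      (k : ℚ) * (4 * (k : ℚ) ^ 2 - 1) / 3 + (b : ℚ) * (4 * (b : ℚ) ^ 2 - 1) / 3 + m := by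
  let g : ℕ → ℚ := fun i => if i = k then 0 else
    (2 * ((if i < k then i + 1 else if i ≤ k + b then k + b - i + 1 else 1 : ℕ) : ℚ) - 1) ^ 2
  have hg : ∑ x ∈ univ.erase (⟨k, hkn⟩ : Fin n),
      (2 * (branchCard (leverBranch (k + b) k) x : ℚ) - 1) ^ 2 = ∑ x : Fin n, g x.val := by
    rw [← add_sum_erase _ _ (mem_univ (⟨k, hkn⟩ : Fin n))]
    have h0 : g k = 0 := if_pos rfl
    rw [h0, zero_add]
    refine sum_congr rfl fun x hx => ?_
    have hx' : x.val ≠ k := fun e => ne_of_mem_erase hx (Fin.ext e)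
    rw [branchCard_lever (by omega) (by omega) x hx']
    simp only [g, if_neg hx']
  rw [hg, Fin.sum_univ_eq_sum_range, hn, sum_range_add, add_right_comm k b 1, sum_range_add,
    sum_range_succ, ← sum_range_odd_sq k, ← sum_range_odd_sq b]
  have h1 : ∀ i ∈ range k, g i = (2 * (i : ℚ) + 1) ^ 2 := by
    intro i hi
    have := mem_range.1 hi
    simp only [g, if_neg this.ne, if_pos this]
    push_cast
    ring
  have h2 : ∑ i ∈ range b, g (k + 1 + i) = ∑ i ∈ range b, (2 * (i : ℚ) + 1) ^ 2 := by
    rw [← sum_range_reflect (fun i : ℕ => (2 * (i : ℚ) + 1) ^ 2)]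
    refine sum_congr rfl fun i hi => ?_
    have := mem_range.1 hi
    have e : k + b - (k + 1 + i) = b - 1 - i := by omega
    simp only [g]
    rw [if_neg (by omega), if_neg (by omega), if_pos (by omega), e]
    push_cast
    ring
  have h3 : ∀ i ∈ range m, g (k + 1 + b + i) = 1 := by
    intro i _
    simp only [g]
    rw [if_neg (by omega), if_neg (by omega), if_neg (by omega)]
    norm_num
  have h4 : g k = 0 := if_pos rfl
  rw [sum_congr rfl h1, h2, sum_congr rfl h3, h4]
  simp

/-- The best meeting time of a lever whose fulcrum is a middle vertex of its path. -/
theorem bestMeet_leverGraph {n k b m : ℕ} (hb : 0 < b) (hkb : k ≤ b) (hbk : b ≤ k + 1)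
    (hn : n = k + b + 1 + m) :
    bestMeet (leverGraph n (k + b) k) =
      ((k : ℚ) * (4 * (k : ℚ) ^ 2 - 1) / 3 + (b : ℚ) * (4 * (b : ℚ) ^ 2 - 1) / 3 + m) /
        (2 * ((n : ℚ) - 1)) := by
  have h := isRooted_leverGraph (n := n) (d := k + b) (k := k) (by omega) (by omega)
  rw [bestMeet, h.Jmin_eq, Fintype.card_fin, ← sum_branchCard_lever hb hn (by omega)]
  · congr!
  intro x hx
  have hx' : x.val ≠ k := fun e => hx (Fin.ext e)
  rw [branchCard_lever (by omega) (by omega) x hx', Fintype.card_fin]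
  split_ifs <;> omega

/-- the best meeting time of the balanced lever `L_{n,d}`. -/
theorem bestMeet_balancedLever (n d : ℕ) (hd2 : 2 ≤ d) (hdn : d ≤ n - 1) :
    (Odd d → bestMeet (balancedLever n d) =
      ((d : ℚ)^3 - (d : ℚ))/(6*((n : ℚ) - 1)) + 1/2) ∧
    (Even d → bestMeet (balancedLever n d) =
      ((d : ℚ)^3 - 4*(d : ℚ))/(6*((n : ℚ) - 1)) + 1/2) := by
  obtain ⟨m, rfl⟩ : ∃ m, n = d + 1 + m := ⟨n - (d + 1), by omega⟩
  have hne : (d : ℚ) + m ≠ 0 := by positivity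
  constructor
  · rintro ⟨k, rfl⟩
    have e : (2 * k + 1) / 2 = k := by omega
    have hsplit : 2 * k + 1 = k + (k + 1) := by ring
    rw [balancedLever, e, hsplit, bestMeet_leverGraph (m := m) (by omega) (by omega) (by omega) rfl]
    push_cast at hne ⊢
    have hn : (k : ℚ) + (k + 1) + 1 + m - 1 = 2 * k + 1 + m := by ring
    rw [hn]
    field_simp
    ring
  · rintro ⟨k, rfl⟩
    have e : (k + k) / 2 = k := by omega
    rw [balancedLever, e, bestMeet_leverGraph (m := m) (by omega) (by omega) (by omega) rfl]
    push_cast at hne ⊢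
    obtain ⟨N, hN⟩ : ∃ N : ℚ, N = k + k + m := ⟨_, rfl⟩
    have hn : (k : ℚ) + k + 1 + m - 1 = N := by rw [hN]; ring
    have hm : (m : ℚ) = N - 2 * k := by rw [hN]; ring
    rw [← hN] at hne
    rw [hn, hm]
    field_simp
    ring
end

section
/- Let n, d be integers with 2 ≤ d ≤ n−1. For every tree G of order n with diameter d: if d is odd, then T_bestmeet(G) ≥ (d³ − d)/(6(n−1)) + 1/2, and if d is even, then T_bestmeet(G) ≥ (d³ − 4d)/(6(n−1)) + 1/2; in each case equality holds if and only if G is isomorphic to the balanced lever L_{n,d}. -/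
open Finset
open scoped Classical

/-- A parent function rooted at `w`, with depth function `dep`, such that the edges of `G` are
exactly the pairs consisting of a non-root vertex and its parent. -/
structure IsParentMap {V : Type*} (G : SimpleGraph V) (w : V) (par : V → V) (dep : V → ℕ) :
    Prop where
  par_root : par w = w
  dep_root : dep w = 0
  adj : ∀ u, u ≠ w → G.Adj u (par u)
  dep_par : ∀ u, u ≠ w → dep (par u) + 1 = dep u
  eq_of_adj : ∀ u v, G.Adj u v → (u ≠ w ∧ par u = v) ∨ (v ≠ w ∧ par v = u)

theorem SimpleGraph.IsTree.exists_isParentMap {V : Type*} {G : SimpleGraph V} (hT : G.IsTree)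
    (w : V) : ∃ par dep, IsParentMap G w par dep := by
  choose p hp using fun u => (hT.existsUnique_path u w).exists
  have huniq : ∀ u (q : G.Walk u w), q.IsPath → q = p u := fun u q hq =>
    (hT.existsUnique_path u w).unique hq (hp u)
  have hnil : ∀ u, u ≠ w → ¬ (p u).Nil := fun u hu => SimpleGraph.Walk.not_nil_of_ne hu
  have hroot : p w = .nil := (huniq w .nil .nil).symm
  refine ⟨fun u => (p u).snd, fun u => (p u).length, ?_, ?_, ?_, ?_, ?_⟩
  · simp [hroot]
  · simp [hroot]
  · exact fun u hu => (p u).adj_snd (hnil u hu)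
  · intro u hu
    have h := huniq _ (p u).tail (hp u).tail
    have h2 := SimpleGraph.Walk.length_tail_add_one (hnil u hu)
    rw [h] at h2
    exact h2
  · intro u v huv
    by_cases hu : u ∈ (p v).support
    · right
      refine ⟨?_, (hT.isAcyclic.eq_snd_of_adj_start (hp v) huv.symm hu).symm⟩
      rintro rfl
      rw [hroot] at hu
      simp only [SimpleGraph.Walk.support_nil, List.mem_singleton] at hu
      exact huv.ne hu
    · left
      refine ⟨?_, ?_⟩
      · rintro rfl
        exact hu (p v).end_mem_support
      · have h := huniq u (.cons huv (p v)) ((hp v).cons hu)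
        simp [← h]

/-- The descendants of `x` (including `x`) with respect to the parent function `par`. -/
noncomputable def descendants {V : Type*} [Fintype V] (par : V → V) (x : V) : Finset V :=
  Finset.univ.filter fun u => ∃ k, par^[k] u = x

namespace IsParentMap

variable {V : Type*} {G : SimpleGraph V} {w : V} {par : V → V} {dep : V → ℕ}

theorem dep_par_eq (h : IsParentMap G w par dep) (u : V) : dep (par u) = dep u - 1 := by
  by_cases hu : u = w
  · subst hu
    simp [h.par_root, h.dep_root]
  · have := h.dep_par u hu
    omega

theorem dep_iterate (h : IsParentMap G w par dep) (k : ℕ) (u : V) :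
    dep (par^[k] u) = dep u - k := by
  induction k with
  | zero => rfl
  | succ k ih =>
    rw [Function.iterate_succ_apply', h.dep_par_eq, ih]
    omega

theorem dep_eq_zero (h : IsParentMap G w par dep) {u : V} : dep u = 0 ↔ u = w := by
  refine ⟨fun hu => ?_, fun hu => hu ▸ h.dep_root⟩
  by_contra hne
  have := h.dep_par u hne
  omega

theorem iterate_dep (h : IsParentMap G w par dep) (u : V) : par^[dep u] u = w := by
  rw [← h.dep_eq_zero, h.dep_iterate]
  omega

theorem adj_indicator (h : IsParentMap G w par dep) (u v : V) :
    (if G.Adj u v then 1 else 0 : ℕ) =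
      (if u ≠ w ∧ par u = v then 1 else 0) + (if v ≠ w ∧ par v = u then 1 else 0) := by
  by_cases huv : u ≠ w ∧ par u = v
  · have hadj : G.Adj u v := huv.2 ▸ h.adj u huv.1
    have hn : ¬ (v ≠ w ∧ par v = u) := by
      rintro ⟨hv, rfl⟩
      have := h.dep_par v hv
      have := h.dep_par _ huv.1
      rw [huv.2] at this
      omega
    simp [huv, hadj, hn]
  · by_cases hvu : v ≠ w ∧ par v = u
    · have hadj : G.Adj u v := hvu.2 ▸ (h.adj v hvu.1).symm
      simp [huv, hvu, hadj]
    · have hadj : ¬ G.Adj u v := fun hadj => (h.eq_of_adj u v hadj).elim huv hvu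
      simp only [if_neg huv, if_neg hvu, if_neg hadj]

variable [Fintype V]

theorem mem_descendants_iff {x u : V} :
    u ∈ descendants par x ↔ u = x ∨ par u ∈ descendants par x := by
  simp only [descendants, mem_filter, mem_univ, true_and]
  constructor
  · rintro ⟨k, hk⟩
    cases k with
    | zero => exact Or.inl hk
    | succ k => exact Or.inr ⟨k, hk⟩
  · rintro (rfl | ⟨k, hk⟩)
    · exact ⟨0, rfl⟩
    · exact ⟨k + 1, hk⟩

theorem self_mem_descendants (x : V) : x ∈ descendants par x :=
  mem_descendants_iff.2 (Or.inl rfl)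

theorem dep_le_of_mem_descendants (h : IsParentMap G w par dep) {x u : V}
    (hu : u ∈ descendants par x) : dep x ≤ dep u := by
  simp only [descendants, mem_filter, mem_univ, true_and] at hu
  obtain ⟨k, rfl⟩ := hu
  rw [h.dep_iterate]
  omega

theorem eq_of_mem_descendants (h : IsParentMap G w par dep) {x u : V}
    (hu : u ∈ descendants par x) (hd : dep u ≤ dep x) : u = x := by
  rcases mem_descendants_iff.1 hu with hx | hx
  · exact hx
  · by_cases hw : u = w
    · subst hw
      have := h.dep_le_of_mem_descendants hu
      rw [h.dep_root] at this
      exact (h.dep_eq_zero.1 (by omega)).symm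
    · have := h.dep_le_of_mem_descendants hx
      have := h.dep_par u hw
      omega

theorem root_notMem_descendants (h : IsParentMap G w par dep) {x : V} (hx : x ≠ w) :
    w ∉ descendants par x := fun hw =>
  hx (h.eq_of_mem_descendants hw (by simp [h.dep_root])).symm

theorem par_notMem_descendants (h : IsParentMap G w par dep) {x : V} (hx : x ≠ w) :
    par x ∉ descendants par x := fun hp => by
  have := h.dep_le_of_mem_descendants hp
  have := h.dep_par x hx
  omega

theorem card_separating_le_length (h : IsParentMap G w par dep) {u v : V} (p : G.Walk u v) :
    #{x ∈ univ.erase w | ¬ (u ∈ descendants par x ↔ v ∈ descendants par x)} ≤ p.length := by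
  induction p with
  | nil => simp
  | @cons u v t huv p ih =>
    have hstep : ∃ y, ∀ x, x ≠ w → x ≠ y →
        (u ∈ descendants par x ↔ v ∈ descendants par x) := by
      rcases h.eq_of_adj u v huv with ⟨-, rfl⟩ | ⟨-, rfl⟩
      · refine ⟨u, fun x _ hx => ?_⟩
        rw [mem_descendants_iff (u := u)]
        simp [hx.symm]
      · refine ⟨v, fun x _ hx => ?_⟩
        rw [mem_descendants_iff (u := v)]
        simp [hx.symm]
    obtain ⟨y, hy⟩ := hstep
    rw [SimpleGraph.Walk.length_cons]
    calc _ ≤ #(insert y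
          {x ∈ univ.erase w | ¬ (v ∈ descendants par x ↔ t ∈ descendants par x)}) := by
          refine card_le_card fun x hx => ?_
          simp only [mem_filter, mem_erase, mem_univ, and_true, mem_insert] at hx ⊢
          by_cases hxy : x = y
          · exact Or.inl hxy
          · right
            rwa [← hy x hx.1 hxy]
      _ ≤ _ := (card_insert_le _ _).trans (by omega)

theorem dist_le_card_separating (h : IsParentMap G w par dep) (hG : G.Connected) (u v : V) :
    G.dist u v ≤
      #{x ∈ univ.erase w | ¬ (u ∈ descendants par x ↔ v ∈ descendants par x)} := by
  induction hN : dep u + dep v using Nat.strong_induction_on generalizing u v with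
  | _ N ih =>
    wlog huv : dep v ≤ dep u generalizing u v
    · rw [SimpleGraph.dist_comm]
      refine (this v u (by omega) (by omega)).trans_eq ?_
      congr 1
      ext x
      simp only [mem_filter]
      tauto
    by_cases hne : u = v
    · simp [hne]
    have hu : u ≠ w := by
      rintro rfl
      rw [h.dep_root] at huv
      exact hne ((h.dep_eq_zero.1 (by omega)).symm)
    have hpar := ih _ (by have := h.dep_par u hu; omega) (par u) v rfl
    have hd : G.dist u v ≤ 1 + G.dist (par u) v := by
      refine hG.dist_triangle.trans (Nat.add_le_add_right ?_ _)
      exact (SimpleGraph.dist_eq_one_iff_adj.2 (h.adj u hu)).le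
    have hv : v ∉ descendants par u := fun hv => hne (h.eq_of_mem_descendants hv huv).symm
    have hlt : #{x ∈ univ.erase w | ¬ (par u ∈ descendants par x ↔ v ∈ descendants par x)} <
        #{x ∈ univ.erase w | ¬ (u ∈ descendants par x ↔ v ∈ descendants par x)} := by
      refine card_lt_card ((ssubset_iff_of_subset fun x hx => ?_).2 ⟨u, ?_, ?_⟩)
      · simp only [mem_filter, mem_erase, mem_univ, and_true] at hx ⊢
        refine ⟨hx.1, ?_⟩
        have hxu : x ≠ u := by
          rintro rfl
          exact hx.2 (iff_of_false (h.par_notMem_descendants hu) hv)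
        rw [mem_descendants_iff (u := u)]
        simpa [hxu.symm] using hx.2
      · simp [hu, hv, self_mem_descendants]
      · simp [hv, h.par_notMem_descendants hu]
    omega

theorem dist_eq_card_separating (h : IsParentMap G w par dep) (hG : G.Connected) (u v : V) :
    G.dist u v =
      #{x ∈ univ.erase w | ¬ (u ∈ descendants par x ↔ v ∈ descendants par x)} := by
  obtain ⟨p, hp⟩ := hG.exists_walk_length_eq_dist u v
  exact (h.dist_le_card_separating hG u v).antisymm (hp ▸ h.card_separating_le_length p)

theorem ell_eq_sum (h : IsParentMap G w par dep) (hG : G.Connected) (u v : V) :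
    ell G u v w = ∑ x ∈ univ.erase w,
      (if u ∈ descendants par x then 1 else 0) * (if v ∈ descendants par x then 1 else 0) := by
  rw [ell, h.dist_eq_card_separating hG, h.dist_eq_card_separating hG,
    h.dist_eq_card_separating hG]
  simp only [card_filter, Nat.cast_sum, ← sum_add_distrib, ← sum_sub_distrib, sum_div]
  refine sum_congr rfl fun x hx => ?_
  have hw := h.root_notMem_descendants (ne_of_mem_erase hx)
  by_cases hu : u ∈ descendants par x <;> by_cases hv : v ∈ descendants par x <;>
    simp [hu, hv, hw]

theorem sum_gdeg_descendants (h : IsParentMap G w par dep) {x : V} (hx : x ≠ w) :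
    ∑ u ∈ descendants par x, gdeg G u + 1 = 2 * #(descendants par x) := by
  have hroot := h.root_notMem_descendants hx
  have hsum : ∑ u ∈ descendants par x, gdeg G u =
      ∑ u ∈ descendants par x, ∑ v, (if u ≠ w ∧ par u = v then 1 else 0) +
      ∑ v, ∑ u ∈ descendants par x, (if v ≠ w ∧ par v = u then 1 else 0) := by
    rw [sum_comm (s := univ), ← sum_add_distrib]
    refine sum_congr rfl fun u _ => ?_
    rw [← sum_add_distrib, gdeg, card_filter]
    exact sum_congr rfl fun v _ => h.adj_indicator u v
  have h1 : ∑ u ∈ descendants par x, ∑ v, (if u ≠ w ∧ par u = v then 1 else 0) =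
      #(descendants par x) := by
    rw [card_eq_sum_ones]
    refine sum_congr rfl fun u hu => ?_
    have : u ≠ w := fun he => hroot (he ▸ hu)
    simp [this]
  have h2 : ∑ v, ∑ u ∈ descendants par x, (if v ≠ w ∧ par v = u then 1 else 0) =
      #((descendants par x).erase x) := by
    rw [← filter_univ_mem ((descendants par x).erase x), card_filter]
    refine sum_congr rfl fun v _ => ?_
    have hiff : v ∈ (descendants par x).erase x ↔ v ≠ w ∧ par v ∈ descendants par x := by
      rw [mem_erase, mem_descendants_iff (u := v)]
      constructor
      · rintro ⟨h1, h2⟩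
        have h2 := h2.resolve_left h1
        refine ⟨?_, h2⟩
        rintro rfl
        exact hroot (h.par_root ▸ h2)
      · rintro ⟨-, h2⟩
        refine ⟨?_, Or.inr h2⟩
        rintro rfl
        exact h.par_notMem_descendants hx h2
    simp only [hiff]
    by_cases hv : v = w <;> simp [hv]
  rw [hsum, h1, h2, card_erase_of_mem (self_mem_descendants x)]
  have : 0 < #(descendants par x) := card_pos.2 ⟨x, self_mem_descendants x⟩
  omega

theorem joinTime_eq (h : IsParentMap G w par dep) (hG : G.Connected) :
    joinTime G w = ∑ x ∈ univ.erase w, (2 * (#(descendants par x) : ℚ) - 1) ^ 2 := by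
  have hdeg : ∀ x ∈ univ.erase w, (2 * (#(descendants par x) : ℚ) - 1) ^ 2 =
      ∑ u, ∑ v, (gdeg G u : ℚ) * (((if u ∈ descendants par x then 1 else 0) *
        (if v ∈ descendants par x then 1 else 0)) * (gdeg G v : ℚ)) := by
    intro x hx
    have hs : (2 * (#(descendants par x) : ℚ) - 1) = ∑ u ∈ descendants par x, (gdeg G u : ℚ) := by
      have := h.sum_gdeg_descendants (ne_of_mem_erase hx)
      have : ((∑ u ∈ descendants par x, gdeg G u + 1 : ℕ) : ℚ) =
        ((2 * #(descendants par x) : ℕ) : ℚ) := by rw [this]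
      push_cast at this
      linarith
    have hs' : ∑ u ∈ descendants par x, (gdeg G u : ℚ) =
        ∑ u, (if u ∈ descendants par x then 1 else 0) * (gdeg G u : ℚ) := by
      simp
    rw [hs, hs', sq, sum_mul_sum]
    refine sum_congr rfl fun u _ => sum_congr rfl fun v _ => ?_
    ring
  rw [sum_congr rfl hdeg, joinTime, sum_comm]
  refine sum_congr rfl fun u _ => ?_
  rw [hitTime, mul_sum, sum_comm]
  refine sum_congr rfl fun v _ => ?_
  rw [h.ell_eq_sum hG, sum_mul, mul_sum]

end IsParentMap

/-- The contribution `(2 * s - 1) ^ 2 - 1` to the joining time of a subtree with `s` vertices. -/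
def excess (s : ℕ) : ℚ := 4 * s * (s - 1)

theorem excess_nonneg (s : ℕ) : 0 ≤ excess s := by
  rcases Nat.eq_zero_or_pos s with rfl | hs
  · simp [excess]
  · have : (1 : ℚ) ≤ s := by exact_mod_cast hs
    have : (0 : ℚ) ≤ s - 1 := by linarith
    unfold excess
    positivity

theorem excess_mono : Monotone excess := by
  refine monotone_nat_of_le_succ fun s => ?_
  have : (0 : ℚ) ≤ s := s.cast_nonneg
  simp only [excess]
  push_cast
  nlinarith

theorem eq_of_excess_le {s t : ℕ} (ht : 1 ≤ t) (hts : t ≤ s) (h : excess s ≤ excess t) :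
    s = t := by
  have ht' : (1 : ℚ) ≤ t := by exact_mod_cast ht
  have hts' : (t : ℚ) ≤ s := by exact_mod_cast hts
  have : (s : ℚ) ≤ t := by
    by_contra! hlt
    unfold excess at h
    nlinarith
  exact le_antisymm (by exact_mod_cast this) hts

/-- The number of vertices of the subtree hanging at the spine vertex `v_i ≠ v_p` of a lever with
fulcrum `v_p` and arms of lengths `p` and `q`. -/
def leverSize (p q i : ℕ) : ℕ :=
  if i < p then i + 1 else if i = p then 0 else p + q + 1 - i

theorem sum_excess_range (p : ℕ) :
    ∑ i ∈ range p, excess (i + 1) = 4 / 3 * ((p : ℚ) ^ 3 - p) := by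
  induction p with
  | zero => simp
  | succ p ih =>
    rw [sum_range_succ, ih, excess]
    push_cast
    ring

/-- The total excess of the non-fulcrum vertices of a lever with arms of lengths `p` and `q`. -/
def leverExcess (p q : ℕ) : ℚ := 4 / 3 * (((p : ℚ) ^ 3 - p) + ((q : ℚ) ^ 3 - q))

theorem leverExcess_comm (p q : ℕ) : leverExcess p q = leverExcess q p := by
  rw [leverExcess, add_comm, ← leverExcess]

theorem sum_excess_leverSize (p q : ℕ) :
    ∑ i ∈ range (p + q + 1), excess (leverSize p q i) =
      leverExcess p q := by
  rw [leverExcess, add_assoc, sum_range_add, sum_range_succ', mul_add, ← sum_excess_range,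
    ← sum_excess_range]
  have h1 : ∑ i ∈ range p, excess (leverSize p q i) = ∑ i ∈ range p, excess (i + 1) :=
    sum_congr rfl fun i hi => by rw [leverSize, if_pos (mem_range.1 hi)]
  have h2 : ∑ i ∈ range q, excess (leverSize p q (p + (i + 1))) =
      ∑ i ∈ range q, excess (i + 1) := by
    rw [← sum_range_reflect]
    refine sum_congr rfl fun i hi => ?_
    have := mem_range.1 hi
    congr 1
    unfold leverSize
    split_ifs <;> omega
  have h3 : excess (leverSize p q (p + 0)) = 0 := by simp [leverSize, excess]
  rw [h1, h2, h3, add_zero]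

theorem sum_excess_leverSize_erase (p q : ℕ) :
    ∑ i ∈ (range (p + q + 1)).erase p, excess (leverSize p q i) =
      leverExcess p q := by
  rw [← sum_excess_leverSize]
  exact sum_erase _ (by simp [leverSize, excess])

/-- The vertex `par^[p] a = par^[q] b` is the lowest common ancestor of `a` and `b`. -/
structure IsApex {V : Type*} (par : V → V) (a b : V) (p q : ℕ) : Prop where
  meet : par^[p] a = par^[q] b
  left : ∀ i < p, ∀ j, par^[i] a ≠ par^[j] b
  right : ∀ j < q, ∀ i, par^[j] b ≠ par^[i] a

theorem IsApex.symm {V : Type*} {par : V → V} {a b : V} {p q : ℕ} (h : IsApex par a b p q) :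
    IsApex par b a q p :=
  ⟨h.meet.symm, h.right, h.left⟩

/-- The path from `a` up to the lowest common ancestor of `a` and `b`, and down to `b`. -/
def spine {V : Type*} (par : V → V) (a b : V) (p q i : ℕ) : V :=
  if i ≤ p then par^[i] a else par^[p + q - i] b

theorem spine_of_le {V : Type*} {par : V → V} {a b : V} {p q i : ℕ} (hi : i ≤ p) :
    spine par a b p q i = par^[i] a := if_pos hi

theorem IsApex.spine_of_ge {V : Type*} {par : V → V} {a b : V} {p q i : ℕ}
    (h : IsApex par a b p q) (hi : p ≤ i) : spine par a b p q i = par^[p + q - i] b := by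
  rcases hi.eq_or_lt with rfl | hi
  · rw [spine_of_le le_rfl, h.meet, Nat.add_sub_cancel_left]
  · exact if_neg (by omega)

namespace IsParentMap

variable {V : Type*} {G : SimpleGraph V} {w : V} {par : V → V} {dep : V → ℕ}

theorem exists_isApex (h : IsParentMap G w par dep) (a b : V) : ∃ p q, IsApex par a b p q := by
  have hp : ∃ i j, par^[i] a = par^[j] b := ⟨dep a, dep b, by rw [h.iterate_dep, h.iterate_dep]⟩
  have hq : ∃ j i, par^[j] b = par^[i] a := ⟨dep b, dep a, by rw [h.iterate_dep, h.iterate_dep]⟩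
  have hleft : ∀ i < Nat.find hp, ∀ j, par^[i] a ≠ par^[j] b := fun i hi j hij =>
    Nat.find_min hp hi ⟨j, hij⟩
  have hright : ∀ j < Nat.find hq, ∀ i, par^[j] b ≠ par^[i] a := fun j hj i hij =>
    Nat.find_min hq hj ⟨i, hij⟩
  refine ⟨Nat.find hp, Nat.find hq, ?_, hleft, hright⟩
  obtain ⟨j, hj⟩ := Nat.find_spec hp
  obtain ⟨i, hi⟩ := Nat.find_spec hq
  generalize Nat.find hp = p at *
  generalize Nat.find hq = q at *
  have hqj : q ≤ j := by
    by_contra! hlt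
    exact hright j hlt p hj.symm
  have hpi : p ≤ i := by
    by_contra! hlt
    exact hleft i hlt q hi.symm
  have hj' : par^[p] a = par^[j - q] (par^[q] b) := by
    rw [hj, ← Function.iterate_add_apply, Nat.sub_add_cancel hqj]
  have hi' : par^[q] b = par^[i - p] (par^[p] a) := by
    rw [hi, ← Function.iterate_add_apply, Nat.sub_add_cancel hpi]
  have hdj := congrArg dep hj'
  have hdi := congrArg dep hi'
  rw [h.dep_iterate (j - q)] at hdj
  rw [h.dep_iterate (i - p)] at hdi
  by_cases h0 : dep (par^[p] a) = 0
  · rw [h.dep_eq_zero.1 h0, h.dep_eq_zero.1 (show dep (par^[q] b) = 0 by omega)]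
  · rw [hj', show j - q = 0 by omega]
    rfl

theorem lt_dep_of_lt (h : IsParentMap G w par dep) {a b : V} {p q : ℕ}
    (hA : IsApex par a b p q) {i : ℕ} (hi : i < p) : i < dep a := by
  by_contra! hle
  refine hA.left i hi (dep b) ?_
  rw [h.iterate_dep, ← h.dep_eq_zero, h.dep_iterate]
  omega

theorem le_dep (h : IsParentMap G w par dep) {a b : V} {p q : ℕ}
    (hA : IsApex par a b p q) : p ≤ dep a := by
  by_contra! hlt
  exact (h.lt_dep_of_lt hA hlt).false

theorem dist_iterate_le (h : IsParentMap G w par dep) (hG : G.Connected) (u : V) (k : ℕ) :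
    G.dist u (par^[k] u) ≤ k := by
  induction k with
  | zero => simp
  | succ k ih =>
    rw [Function.iterate_succ_apply']
    refine (hG.dist_triangle (v := par^[k] u)).trans (Nat.add_le_add ih ?_)
    by_cases hw : par^[k] u = w
    · simp [hw, h.par_root]
    · exact (SimpleGraph.dist_eq_one_iff_adj.2 (h.adj _ hw)).le

theorem dist_le_of_isApex (h : IsParentMap G w par dep) (hG : G.Connected) {a b : V} {p q : ℕ}
    (hA : IsApex par a b p q) : G.dist a b ≤ p + q := by
  refine (hG.dist_triangle (v := par^[p] a)).trans (Nat.add_le_add (h.dist_iterate_le hG a p) ?_)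
  rw [hA.meet, SimpleGraph.dist_comm]
  exact h.dist_iterate_le hG b q

theorem iterate_inj (h : IsParentMap G w par dep) {a : V} {i j : ℕ} (hi : i ≤ dep a)
    (hj : j ≤ dep a) (hij : par^[i] a = par^[j] a) : i = j := by
  have := congrArg dep hij
  rw [h.dep_iterate, h.dep_iterate] at this
  omega

theorem spine_injOn (h : IsParentMap G w par dep) {a b : V} {p q : ℕ}
    (hA : IsApex par a b p q) : Set.InjOn (spine par a b p q) (Set.Iic (p + q)) := by
  intro i hi j hj hij
  simp only [Set.mem_Iic] at hi hj
  wlog hle : i ≤ j generalizing i j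
  · exact (this hij.symm hj hi (by omega)).symm
  have ha := h.le_dep hA
  have hb := h.le_dep hA.symm
  by_cases hjp : j ≤ p
  · rw [spine_of_le hjp, spine_of_le (by omega)] at hij
    exact h.iterate_inj (by omega) (by omega) hij
  by_cases hip : p ≤ i
  · rw [hA.spine_of_ge hip, hA.spine_of_ge (by omega)] at hij
    have := h.iterate_inj (by omega) (by omega) hij
    omega
  · rw [spine_of_le (by omega), hA.spine_of_ge (by omega)] at hij
    exact absurd hij (hA.left i (by omega) _)

theorem spine_ne_root (h : IsParentMap G w par dep) {a b : V} {p q : ℕ}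
    (hA : IsApex par a b p q) {i : ℕ} (hi : i ≤ p + q) (hip : i ≠ p) :
    spine par a b p q i ≠ w := by
  rw [Ne, ← h.dep_eq_zero]
  rcases lt_or_gt_of_ne hip with hlt | hgt
  · have := h.lt_dep_of_lt hA hlt
    rw [spine_of_le hlt.le, h.dep_iterate]
    omega
  · have := h.lt_dep_of_lt hA.symm (show p + q - i < q by omega)
    rw [hA.spine_of_ge hgt.le, h.dep_iterate]
    omega

theorem card_image_iterate (h : IsParentMap G w par dep) {a : V} {k : ℕ} (hk : k ≤ dep a) :
    #((range (k + 1)).image (fun j => par^[j] a)) = k + 1 := by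
  rw [card_image_of_injOn, card_range]
  intro i hi j hj hij
  simp only [coe_range, Set.mem_Iio] at hi hj
  exact h.iterate_inj (by omega) (by omega) hij

variable [Fintype V]

theorem iterate_mem_descendants {a : V} {j k : ℕ} (hjk : j ≤ k) :
    par^[j] a ∈ descendants par (par^[k] a) := by
  simp only [descendants, mem_filter, mem_univ, true_and]
  exact ⟨k - j, by rw [← Function.iterate_add_apply, Nat.sub_add_cancel hjk]⟩

theorem image_iterate_subset {a : V} (k : ℕ) :
    (range (k + 1)).image (fun j => par^[j] a) ⊆ descendants par (par^[k] a) := by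
  intro x hx
  obtain ⟨j, hj, rfl⟩ := mem_image.1 hx
  exact iterate_mem_descendants (Nat.lt_succ_iff.1 (mem_range.1 hj))

theorem lt_card_descendants_iterate (h : IsParentMap G w par dep) {a : V} {k : ℕ}
    (hk : k ≤ dep a) : k + 1 ≤ #(descendants par (par^[k] a)) :=
  (h.card_image_iterate hk).symm.le.trans (card_le_card (image_iterate_subset k))

theorem eq_iterate_of_mem_descendants (h : IsParentMap G w par dep) {a y : V} {k : ℕ}
    (hk : k ≤ dep a) (hcard : #(descendants par (par^[k] a)) = k + 1)
    (hy : y ∈ descendants par (par^[k] a)) : ∃ j ≤ k, par^[j] a = y := by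
  rw [← eq_of_subset_of_card_le (image_iterate_subset k)
    (by rw [h.card_image_iterate hk, hcard])] at hy
  obtain ⟨j, hj, hjy⟩ := mem_image.1 hy
  exact ⟨j, Nat.lt_succ_iff.1 (mem_range.1 hj), hjy⟩

theorem leverSize_le_card_descendants (h : IsParentMap G w par dep) {a b : V} {p q : ℕ}
    (hA : IsApex par a b p q) {i : ℕ} (hi : i ≤ p + q) (hip : i ≠ p) :
    leverSize p q i ≤ #(descendants par (spine par a b p q i)) := by
  rcases lt_or_gt_of_ne hip with hlt | hgt
  · rw [leverSize, if_pos hlt, spine_of_le hlt.le]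
    exact h.lt_card_descendants_iterate (h.lt_dep_of_lt hA hlt).le
  · rw [leverSize, if_neg hgt.not_gt, if_neg hip, hA.spine_of_ge hgt.le,
      show p + q + 1 - i = p + q - i + 1 by omega]
    exact h.lt_card_descendants_iterate (h.lt_dep_of_lt hA.symm (by omega)).le

theorem joinTime_eq_add (h : IsParentMap G w par dep) (hG : G.Connected) :
    joinTime G w = ((Fintype.card V : ℚ) - 1) +
      ∑ x ∈ univ.erase w, excess #(descendants par x) := by
  have hc : ((Fintype.card V : ℚ) - 1) = ∑ x ∈ univ.erase w, 1 := by
    rw [sum_const, nsmul_one, card_erase_of_mem (mem_univ w), card_univ,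
      Nat.cast_sub (Fintype.card_pos_iff.2 ⟨w⟩), Nat.cast_one]
  rw [h.joinTime_eq hG, hc, ← sum_add_distrib]
  refine sum_congr rfl fun x _ => ?_
  unfold excess
  ring

theorem sum_excess_eq (h : IsParentMap G w par dep) {a b : V} {p q : ℕ}
    (hA : IsApex par a b p q) :
    ∑ x ∈ univ.erase w, excess #(descendants par x) =
      ∑ x ∈ univ.erase w \ ((range (p + q + 1)).erase p).image (spine par a b p q),
        excess #(descendants par x) +
      ∑ i ∈ (range (p + q + 1)).erase p, excess #(descendants par (spine par a b p q i)) := by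
  have hsub : ((range (p + q + 1)).erase p).image (spine par a b p q) ⊆ univ.erase w := by
    intro x hx
    obtain ⟨i, hi, rfl⟩ := mem_image.1 hx
    simp only [mem_erase, mem_range] at hi
    exact mem_erase.2 ⟨h.spine_ne_root hA (by omega) hi.1, mem_univ _⟩
  rw [← sum_sdiff hsub, sum_image]
  intro i hi j hj hij
  simp only [coe_erase, coe_range, Set.mem_sdiff, Set.mem_Iio] at hi hj
  exact h.spine_injOn hA (Set.mem_Iic.2 (by omega)) (Set.mem_Iic.2 (by omega)) hij

theorem excess_leverSize_le (h : IsParentMap G w par dep) {a b : V} {p q : ℕ}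
    (hA : IsApex par a b p q) :
    ∀ i ∈ (range (p + q + 1)).erase p,
      excess (leverSize p q i) ≤ excess #(descendants par (spine par a b p q i)) := by
  intro i hi
  simp only [mem_erase, mem_range] at hi
  exact excess_mono (h.leverSize_le_card_descendants hA (by omega) hi.1)

theorem le_sum_excess (h : IsParentMap G w par dep) {a b : V} {p q : ℕ}
    (hA : IsApex par a b p q) :
    leverExcess p q ≤
      ∑ x ∈ univ.erase w, excess #(descendants par x) := by
  rw [h.sum_excess_eq hA, ← sum_excess_leverSize_erase]
  have := sum_le_sum (h.excess_leverSize_le hA)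
  have : 0 ≤ ∑ x ∈ univ.erase w \ ((range (p + q + 1)).erase p).image (spine par a b p q),
    excess #(descendants par x) := sum_nonneg fun _ _ => excess_nonneg _
  linarith

theorem card_descendants_of_sum_excess_le (h : IsParentMap G w par dep) {a b : V} {p q : ℕ}
    (hA : IsApex par a b p q)
    (hle : ∑ x ∈ univ.erase w, excess #(descendants par x) ≤
      leverExcess p q) :
    (∀ i ≤ p + q, i ≠ p → #(descendants par (spine par a b p q i)) = leverSize p q i) ∧
    (∀ x, x ≠ w → (∀ i ≤ p + q, i ≠ p → spine par a b p q i ≠ x) →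
      #(descendants par x) = 1) := by
  rw [h.sum_excess_eq hA, ← sum_excess_leverSize_erase] at hle
  have hspine := sum_le_sum (h.excess_leverSize_le hA)
  have hrest : 0 ≤ ∑ x ∈ univ.erase w \ ((range (p + q + 1)).erase p).image (spine par a b p q),
    excess #(descendants par x) := sum_nonneg fun _ _ => excess_nonneg _
  constructor
  · intro i hi hip
    have heq := (sum_eq_sum_iff_of_le (h.excess_leverSize_le hA)).1 (by linarith) i
      (mem_erase.2 ⟨hip, mem_range.2 (by omega)⟩)
    refine eq_of_excess_le ?_ (h.leverSize_le_card_descendants hA hi hip) heq.symm.le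
    unfold leverSize
    split_ifs <;> omega
  · intro x hx hxs
    have heq := (sum_eq_zero_iff_of_nonneg fun _ _ => excess_nonneg _).1
      (show _ = (0 : ℚ) by linarith) x (mem_sdiff.2 ⟨mem_erase.2 ⟨hx, mem_univ x⟩, fun hmem => by
        obtain ⟨i, hi, rfl⟩ := mem_image.1 hmem
        simp only [mem_erase, mem_range] at hi
        exact hxs i (by omega) hi.1 rfl⟩)
    refine eq_of_excess_le le_rfl (card_pos.2 ⟨x, self_mem_descendants x⟩) ?_
    rw [heq]
    exact excess_nonneg 1

end IsParentMap

/-- The index of the neighbour of vertex `i` towards the fulcrum `k` in a lever of diameter `d`. -/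
def towardFulcrum (d k i : ℕ) : ℕ :=
  if i < k then i + 1 else if k < i ∧ i ≤ d then i - 1 else k

theorem IsApex.par_spine {V : Type*} {par : V → V} {a b : V} {p q i : ℕ}
    (hA : IsApex par a b p q) (hi : i ≤ p + q) (hip : i ≠ p) :
    par (spine par a b p q i) = spine par a b p q (towardFulcrum (p + q) p i) := by
  rcases lt_or_gt_of_ne hip with hlt | hgt
  · rw [towardFulcrum, if_pos hlt, spine_of_le hlt.le, spine_of_le (Nat.succ_le_of_lt hlt),
      Function.iterate_succ_apply']
  · rw [towardFulcrum, if_neg hgt.not_gt, if_pos ⟨hgt, hi⟩, hA.spine_of_ge hgt.le,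
      hA.spine_of_ge (by omega), ← Function.iterate_succ_apply' par]
    congr 2
    omega

theorem leverGraph_adj {n d k : ℕ} (hk : k ≤ d) (i j : Fin n) :
    (leverGraph n d k).Adj i j ↔
      (i.val ≠ k ∧ towardFulcrum d k i = j.val) ∨ (j.val ≠ k ∧ towardFulcrum d k j = i.val) := by
  rw [leverGraph, SimpleGraph.fromRel_adj, Ne, Fin.ext_iff]
  unfold towardFulcrum
  split_ifs <;> omega

namespace IsParentMap

variable {V : Type*} {G : SimpleGraph V} {w : V} {par : V → V} {dep : V → ℕ}

theorem adj_iff (h : IsParentMap G w par dep) (u v : V) :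
    G.Adj u v ↔ (u ≠ w ∧ par u = v) ∨ (v ≠ w ∧ par v = u) := by
  refine ⟨h.eq_of_adj u v, ?_⟩
  rintro (⟨hu, rfl⟩ | ⟨hv, rfl⟩)
  · exact h.adj u hu
  · exact (h.adj v hv).symm

variable [Fintype V]

theorem spine_apex_eq_root (h : IsParentMap G w par dep) {a b : V} {p q : ℕ}
    (hA : IsApex par a b p q) (hpq : 2 ≤ p + q)
    (hleaf : ∀ x, x ≠ w → (∀ i ≤ p + q, i ≠ p → spine par a b p q i ≠ x) →
      #(descendants par x) = 1) : spine par a b p q p = w := by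
  by_contra hw
  have hone := hleaf _ hw fun i hi hip heq =>
    hip (h.spine_injOn hA (Set.mem_Iic.2 hi) (Set.mem_Iic.2 (by omega)) heq)
  have hp := h.lt_card_descendants_iterate (h.le_dep hA)
  have hq := h.lt_card_descendants_iterate (h.le_dep hA.symm)
  rw [spine_of_le le_rfl] at hone
  rw [← hA.meet] at hq
  omega

theorem par_eq_root_of_leaf (h : IsParentMap G w par dep) {a b : V} {p q : ℕ}
    (hA : IsApex par a b p q)
    (hsize : ∀ i ≤ p + q, i ≠ p → #(descendants par (spine par a b p q i)) = leverSize p q i)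
    (hleaf : ∀ x, x ≠ w → (∀ i ≤ p + q, i ≠ p → spine par a b p q i ≠ x) →
      #(descendants par x) = 1)
    {y : V} (hyw : y ≠ w) (hy : ∀ i ≤ p + q, spine par a b p q i ≠ y) : par y = w := by
  by_contra hz
  have hmem : y ∈ descendants par (par y) :=
    mem_descendants_iff.2 (Or.inr (self_mem_descendants _))
  by_cases hs : ∀ i ≤ p + q, i ≠ p → spine par a b p q i ≠ par y
  · have hself := self_mem_descendants (par := par) (par y)
    have := card_le_one.1 (hleaf _ hz hs).le _ hmem _ hself
    exact (h.adj y hyw).ne this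
  · push Not at hs
    obtain ⟨i, hi, hip, hiy⟩ := hs
    have hc := hsize i hi hip
    rw [← hiy] at hmem
    rcases lt_or_gt_of_ne hip with hlt | hgt
    · rw [leverSize, if_pos hlt, spine_of_le hlt.le] at hc
      rw [spine_of_le hlt.le] at hmem
      obtain ⟨j, hj, hjy⟩ :=
        h.eq_iterate_of_mem_descendants (h.lt_dep_of_lt hA hlt).le hc hmem
      exact hy j (by omega) (by rw [spine_of_le (by omega), hjy])
    · rw [leverSize, if_neg hgt.not_gt, if_neg hip, hA.spine_of_ge hgt.le,
        show p + q + 1 - i = p + q - i + 1 by omega] at hc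
      rw [hA.spine_of_ge hgt.le] at hmem
      obtain ⟨j, hj, hjy⟩ :=
        h.eq_iterate_of_mem_descendants (h.lt_dep_of_lt hA.symm (by omega)).le hc hmem
      refine hy (p + q - j) (by omega) ?_
      rw [hA.spine_of_ge (by omega), show p + q - (p + q - j) = j by omega, hjy]

theorem spine_lt_card (h : IsParentMap G w par dep) {a b : V} {p q : ℕ}
    (hA : IsApex par a b p q) : p + q < Fintype.card V := by
  have hinj : Set.InjOn (spine par a b p q) (range (p + q + 1)) := fun i hi j hj hij => by
    simp only [coe_range, Set.mem_Iio] at hi hj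
    exact h.spine_injOn hA (Set.mem_Iic.2 (by omega)) (Set.mem_Iic.2 (by omega)) hij
  have := card_le_univ ((range (p + q + 1)).image (spine par a b p q))
  rw [card_image_of_injOn hinj, card_range] at this
  omega

theorem nonempty_iso_leverGraph (h : IsParentMap G w par dep) {a b : V} {p q : ℕ}
    (hA : IsApex par a b p q) (hpq : 2 ≤ p + q)
    (hle : ∑ x ∈ univ.erase w, excess #(descendants par x) ≤
      leverExcess p q) :
    Nonempty (G ≃g leverGraph (Fintype.card V) (p + q) p) := by
  obtain ⟨hsize, hleaf⟩ := h.card_descendants_of_sum_excess_le hA hle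
  have hroot := h.spine_apex_eq_root hA hpq hleaf
  have hlt := h.spine_lt_card hA
  obtain ⟨g, hg⟩ := Finset.exists_equiv_extend_of_card_eq (α := Fin (Fintype.card V))
    (t := (univ : Finset V)) (by simp) (s := {i | i.val ≤ p + q})
    (f := fun i => spine par a b p q i) (subset_univ _) (fun i hi j hj hij => by
      simp only [coe_filter, mem_univ, true_and, Set.mem_ofPred_eq] at hi hj
      exact Fin.ext (h.spine_injOn hA (Set.mem_Iic.2 hi) (Set.mem_Iic.2 hj) hij))
  let e : Fin (Fintype.card V) ≃ V := g.trans (Equiv.subtypeUnivEquiv mem_univ)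
  have he : ∀ i : Fin (Fintype.card V), i.val ≤ p + q → e i = spine par a b p q i := fun i hi =>
    hg i (by simpa using hi)
  have hew : ∀ i : Fin (Fintype.card V), e i = w ↔ i.val = p := fun i => by
    have : e ⟨p, by omega⟩ = w := (he ⟨p, by omega⟩ (Nat.le_add_right p q)).trans hroot
    rw [← this, e.injective.eq_iff, Fin.ext_iff]
  have hlt' : ∀ i : Fin (Fintype.card V), towardFulcrum (p + q) p i < Fintype.card V :=
    fun i => by
      unfold towardFulcrum
      split_ifs <;> omega
  have hpar : ∀ i : Fin (Fintype.card V), i.val ≠ p →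
      par (e i) = e ⟨towardFulcrum (p + q) p i, hlt' i⟩ := by
    intro i hip
    by_cases hi : i.val ≤ p + q
    · rw [he i hi, hA.par_spine hi hip, he]
      simp only
      unfold towardFulcrum
      split_ifs <;> omega
    · rw [h.par_eq_root_of_leaf hA hsize hleaf ((hew i).not.2 hip), eq_comm, hew]
      · simp only
        unfold towardFulcrum
        split_ifs <;> omega
      · intro j hj hji
        rw [← he ⟨j, by omega⟩ hj, e.injective.eq_iff, Fin.ext_iff] at hji
        simp only at hji
        omega
  refine ⟨(SimpleGraph.Iso.symm ⟨e, fun {i j} => ?_⟩)⟩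
  rw [h.adj_iff, leverGraph_adj (Nat.le_add_right p q), Ne, Ne, hew, hew]
  refine or_congr (and_congr_right fun hi => ?_) (and_congr_right fun hi => ?_)
  · rw [hpar i hi, e.injective.eq_iff, Fin.ext_iff]
  · rw [hpar j hi, e.injective.eq_iff, Fin.ext_iff]

end IsParentMap

/-- The distance from vertex `i` to the fulcrum `k` in a lever of diameter `d`. -/
def fulcrumDist (d k i : ℕ) : ℕ :=
  if i ≤ k then k - i else if i ≤ d then i - k else 1

theorem towardFulcrum_lt {n d k i : ℕ} (hk : k ≤ d) (hd : d < n) (hi : i < n) :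
    towardFulcrum d k i < n := by
  unfold towardFulcrum
  split_ifs <;> omega

section Lever

variable {V : Type*} {G : SimpleGraph V} {n d k : ℕ}

theorem isParentMap_of_iso (hk : k ≤ d) (hd : d < n) (e : G ≃g leverGraph n d k) :
    IsParentMap G (e.symm ⟨k, hk.trans_lt hd⟩)
      (fun u => e.symm ⟨towardFulcrum d k (e u), towardFulcrum_lt hk hd (e u).isLt⟩)
      (fun u => fulcrumDist d k (e u)) := by
  have hw : ∀ u, u = e.symm ⟨k, hk.trans_lt hd⟩ ↔ (e u).val = k := fun u => by
    rw [← e.injective.eq_iff, RelIso.apply_symm_apply, Fin.ext_iff]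
  refine ⟨?_, ?_, ?_, ?_, ?_⟩
  · simp [towardFulcrum]
  · simp [fulcrumDist]
  · intro u hu
    rw [Ne, hw] at hu
    rw [← e.map_adj_iff, leverGraph_adj hk, RelIso.apply_symm_apply]
    exact Or.inl ⟨hu, rfl⟩
  · intro u hu
    rw [Ne, hw] at hu
    rw [RelIso.apply_symm_apply]
    unfold fulcrumDist towardFulcrum
    simp only
    split_ifs <;> omega
  · intro u v huv
    rw [← e.map_adj_iff, leverGraph_adj hk] at huv
    simp only [Ne, hw]
    refine huv.imp (And.imp_right fun hu => ?_) (And.imp_right fun hu => ?_)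
    · rw [← e.injective.eq_iff, RelIso.apply_symm_apply, Fin.ext_iff]
      exact hu
    · rw [← e.injective.eq_iff, RelIso.apply_symm_apply, Fin.ext_iff]
      exact hu

variable [Fintype V]

theorem of_mem_descendants {par : V → V} {Q : V → Prop} (hQ : ∀ u, Q (par u) → Q u) {x u : V}
    (hx : Q x) (hu : u ∈ descendants par x) : Q u := by
  simp only [descendants, mem_filter, mem_univ, true_and] at hu
  obtain ⟨k, rfl⟩ := hu
  induction k generalizing u with
  | zero => exact hx
  | succ k ih => exact hQ u (ih hx)

theorem excess_descendants_le {par : V → V} {φ : V → ℕ} (hφ : Function.Injective φ)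
    {p q : ℕ} (hpar : ∀ u, φ (par u) = towardFulcrum (p + q) p (φ u)) {x : V} (hx : φ x ≠ p) :
    excess #(descendants par x) ≤ excess (leverSize p q (φ x)) := by
  have hcard : ∀ (s : Finset ℕ), (∀ u, φ (par u) ∈ s → φ u ∈ s) → φ x ∈ s →
      #(descendants par x) ≤ #s := fun s hs hxs => by
    refine card_le_card_of_injOn φ (fun u hu => ?_) hφ.injOn
    exact of_mem_descendants (Q := fun u => φ u ∈ s) hs hxs hu
  by_cases h1 : φ x < p
  · rw [leverSize, if_pos h1]
    refine excess_mono ((hcard (range (φ x + 1)) (fun u hu => ?_) (by simp)).trans_eq (by simp))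
    rw [hpar, mem_range] at hu
    rw [mem_range]
    revert hu
    unfold towardFulcrum
    split_ifs <;> omega
  · rw [leverSize, if_neg h1, if_neg hx]
    by_cases h2 : φ x ≤ p + q
    · refine excess_mono ((hcard (Icc (φ x) (p + q)) (fun u hu => ?_) (by simp [h2])).trans_eq
        (by simp))
      rw [hpar, mem_Icc] at hu
      rw [mem_Icc]
      revert hu
      unfold towardFulcrum
      split_ifs <;> omega
    · have hone := hcard {φ x} (fun u hu => ?_) (by simp)
      · rw [card_singleton] at hone
        refine (excess_mono hone).trans ?_
        rw [show p + q + 1 - φ x = 0 by omega]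
        simp [excess]
      · rw [hpar, mem_singleton] at hu
        exfalso
        revert hu
        unfold towardFulcrum
        split_ifs <;> omega

theorem joinTime_le_of_iso {p q : ℕ} (hG : G.Connected) (hd : p + q < n)
    (e : G ≃g leverGraph n (p + q) p) :
    joinTime G (e.symm ⟨p, (Nat.le_add_right p q).trans_lt hd⟩) ≤
      ((Fintype.card V : ℚ) - 1) + leverExcess p q := by
  rw [(isParentMap_of_iso (Nat.le_add_right p q) hd e).joinTime_eq_add hG]
  refine add_le_add_right ?_ _
  rw [← sum_excess_leverSize]
  calc _ ≤ ∑ x ∈ univ.erase (e.symm ⟨p, (Nat.le_add_right p q).trans_lt hd⟩),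
        excess (leverSize p q (e x)) := by
        refine sum_le_sum fun x hx => ?_
        refine excess_descendants_le (φ := fun u => (e u).val)
          (Fin.val_injective.comp e.injective) (fun u => by simp) fun hxp => ?_
        refine ne_of_mem_erase hx ?_
        rw [← e.injective.eq_iff, RelIso.apply_symm_apply, Fin.ext_iff]
        exact hxp
    _ ≤ ∑ x, excess (leverSize p q (e x)) :=
        sum_le_sum_of_subset_of_nonneg (erase_subset _ _) fun _ _ _ => excess_nonneg _
    _ = ∑ i : Fin n, excess (leverSize p q i) :=
        e.toEquiv.sum_comp fun i : Fin n => excess (leverSize p q i)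
    _ = ∑ i ∈ range n, excess (leverSize p q i) :=
        Fin.sum_univ_eq_sum_range (fun i => excess (leverSize p q i)) n
    _ = _ := by
        refine (sum_subset (range_subset_range.2 (by omega)) fun i _ hi => ?_).symm
        rw [mem_range] at hi
        rw [leverSize, if_neg (by omega), if_neg (by omega), show p + q + 1 - i = 0 by omega]
        simp [excess]

end Lever

theorem leverExcess_balanced_le {p q d : ℕ} (hd : 2 ≤ d) (hpq : d ≤ p + q) :
    leverExcess (d / 2) (d - d / 2) ≤ leverExcess p q ∧
    (leverExcess p q ≤ leverExcess (d / 2) (d - d / 2) →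
      p + q = d ∧ (p = d / 2 ∨ q = d / 2)) := by
  wlog hle : p ≤ q generalizing p q
  · have := this (p := q) (q := p) (by omega) (by omega)
    rw [leverExcess_comm q, add_comm q p, or_comm] at this
    exact this
  obtain ⟨P, hP⟩ : ∃ P, d / 2 = P := ⟨_, rfl⟩
  obtain ⟨Q, hQ⟩ : ∃ Q, d - P = Q := ⟨_, rfl⟩
  rw [hP, hQ]
  by_cases heq : p = P ∧ q = Q
  · rw [heq.1, heq.2]
    exact ⟨le_rfl, fun _ => ⟨by omega, Or.inl rfl⟩⟩
  suffices hlt : (P : ℚ) ^ 3 - P + (Q ^ 3 - Q) < p ^ 3 - p + (q ^ 3 - q) from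
    by
    unfold leverExcess
    exact ⟨by linarith, fun h => by linarith⟩
  have key : (P : ℤ) ^ 3 - P + (Q ^ 3 - Q) < p ^ 3 - p + (q ^ 3 - q) := by
    have hPQ : (P : ℤ) ≤ Q := by omega
    have hP1 : (1 : ℤ) ≤ P := by omega
    have hp0 : (0 : ℤ) ≤ p := by omega
    rcases (show Q ≤ q by omega).eq_or_lt with rfl | hQq
    · have hPp : (P : ℤ) + 1 ≤ p := by omega
      nlinarith [mul_pos (show (0 : ℤ) < p - P by omega)
        (show (0 : ℤ) < p ^ 2 + p * P + P ^ 2 - 1 by nlinarith)]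
    · have hQq' : (Q : ℤ) + 1 ≤ q := by omega
      have hgain : (q - Q : ℤ) * (3 * P ^ 2) < (q - Q) * (q ^ 2 + q * Q + Q ^ 2 - 1) :=
        mul_lt_mul_of_pos_left (by nlinarith) (by omega)
      rcases le_or_gt P p with hPp | hpP
      · have hPp' : (P : ℤ) ≤ p := by omega
        nlinarith [mul_nonneg (show (0 : ℤ) ≤ p - P by omega)
          (show (0 : ℤ) ≤ p ^ 2 + p * P + P ^ 2 - 1 by nlinarith),
          mul_nonneg (show (0 : ℤ) ≤ q - Q by omega) (sq_nonneg (P : ℤ))]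
      · have hpP' : (p : ℤ) + 1 ≤ P := by omega
        have hloss : (P - p : ℤ) * (P ^ 2 + P * p + p ^ 2 - 1) ≤ (P - p) * (3 * P ^ 2) :=
          mul_le_mul_of_nonneg_left (by nlinarith) (by omega)
        have hstep : (P - p : ℤ) * (3 * P ^ 2) ≤ (q - Q) * (3 * P ^ 2) :=
          mul_le_mul_of_nonneg_right (by omega) (by positivity)
        linarith
  exact_mod_cast key

theorem leverExcess_balanced (d : ℕ) :
    (Odd d → leverExcess (d / 2) (d - d / 2) = ((d : ℚ) ^ 3 - d) / 3) ∧
    (Even d → leverExcess (d / 2) (d - d / 2) = ((d : ℚ) ^ 3 - 4 * d) / 3) := by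
  constructor
  · rintro ⟨m, rfl⟩
    rw [show 2 * m + 1 - (2 * m + 1) / 2 = m + 1 by omega, show (2 * m + 1) / 2 = m by omega]
    simp only [leverExcess]
    push_cast
    ring
  · rintro ⟨m, rfl⟩
    rw [show m + m - (m + m) / 2 = m by omega, show (m + m) / 2 = m by omega]
    simp only [leverExcess]
    push_cast
    ring

theorem exists_dist_eq_gdiam {V : Type*} [Fintype V] [Nonempty V] (G : SimpleGraph V) :
    ∃ a b, G.dist a b = gdiam G := by
  obtain ⟨⟨a, b⟩, -, hab⟩ := exists_mem_eq_sup (univ : Finset (V × V)) univ_nonempty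
    fun p => G.dist p.1 p.2
  exact ⟨a, b, hab.symm⟩

section BestMeet

variable {V : Type*} [Fintype V] {G : SimpleGraph V} {d : ℕ}

theorem le_joinTime (hT : G.IsTree) (hd2 : 2 ≤ d) (hdiam : gdiam G = d) (w : V) :
    ((Fintype.card V : ℚ) - 1) + leverExcess (d / 2) (d - d / 2) ≤ joinTime G w ∧
    (joinTime G w ≤
      ((Fintype.card V : ℚ) - 1) + leverExcess (d / 2) (d - d / 2) →
      Nonempty (G ≃g balancedLever (Fintype.card V) d)) := by
  obtain ⟨par, dep, h⟩ := hT.exists_isParentMap w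
  have : Nonempty V := ⟨w⟩
  obtain ⟨a, b, hab⟩ := exists_dist_eq_gdiam G
  obtain ⟨p, q, hA⟩ := h.exists_isApex a b
  have hdpq := h.dist_le_of_isApex hT.connected hA
  rw [hab, hdiam] at hdpq
  obtain ⟨hmin, hext⟩ := leverExcess_balanced_le hd2 hdpq
  have hbound := h.le_sum_excess hA
  rw [h.joinTime_eq_add hT.connected]
  refine ⟨by linarith, fun hle => ?_⟩
  have hle' := (le_of_add_le_add_left hle).trans hmin
  obtain ⟨hd, hp | hq⟩ := hext (by linarith)
  · rw [balancedLever, ← hp, ← hd]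
    exact h.nonempty_iso_leverGraph hA (by omega) hle'
  · rw [balancedLever, ← hq, ← hd, add_comm p q]
    rw [leverExcess_comm] at hle'
    exact h.nonempty_iso_leverGraph hA.symm (by omega) hle'

theorem exists_joinTime_le (hT : G.IsTree) (hd : d < Fintype.card V)
    (e : G ≃g balancedLever (Fintype.card V) d) :
    ∃ w, joinTime G w ≤
      ((Fintype.card V : ℚ) - 1) + leverExcess (d / 2) (d - d / 2) := by
  have hsplit : d / 2 + (d - d / 2) = d := by omega
  rw [← hsplit] at hd
  have e' : G ≃g leverGraph (Fintype.card V) (d / 2 + (d - d / 2)) (d / 2) := by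
    rw [hsplit]
    exact e
  exact ⟨_, joinTime_le_of_iso hT.connected hd e'⟩

theorem bestMeet_eq [Nonempty V] : ∃ w, (∀ v, joinTime G w ≤ joinTime G v) ∧
    bestMeet G = joinTime G w / (2 * ((Fintype.card V : ℚ) - 1)) := by
  obtain ⟨w, -, hw⟩ := exists_mem_eq_inf' (univ_nonempty (α := V)) (joinTime G)
  refine ⟨w, fun v => ?_, ?_⟩
  · rw [← hw]
    exact inf'_le _ (mem_univ v)
  · rw [bestMeet, Jmin, dif_pos ‹Nonempty V›, hw]

theorem bestMeet_bound (hT : G.IsTree) (hd2 : 2 ≤ d) (hd : d < Fintype.card V)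
    (hdiam : gdiam G = d) {M : ℚ}
    (hM : leverExcess (d / 2) (d - d / 2) = M / 3) :
    M / (6 * ((Fintype.card V : ℚ) - 1)) + 1 / 2 ≤ bestMeet G ∧
      (bestMeet G = M / (6 * ((Fintype.card V : ℚ) - 1)) + 1 / 2 ↔
        Nonempty (G ≃g balancedLever (Fintype.card V) d)) := by
  have : Nonempty V := hT.connected.nonempty
  obtain ⟨w, hmin, hbest⟩ := bestMeet_eq (G := G)
  have hpos : (0 : ℚ) < (Fintype.card V : ℚ) - 1 := by
    have : ((2 : ℕ) : ℚ) < (Fintype.card V : ℚ) := by exact_mod_cast hd2.trans_lt hd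
    push_cast at this
    linarith
  have hform : M / (6 * ((Fintype.card V : ℚ) - 1)) + 1 / 2 =
      (((Fintype.card V : ℚ) - 1) + M / 3) / (2 * ((Fintype.card V : ℚ) - 1)) := by
    field_simp
    ring
  obtain ⟨hlow, hrigid⟩ := le_joinTime hT hd2 hdiam w
  rw [hM] at hlow hrigid
  rw [hbest, hform]
  refine ⟨by gcongr, ?_⟩
  rw [div_left_inj' (by positivity)]
  refine ⟨fun heq => hrigid heq.le, fun ⟨e⟩ => ?_⟩
  obtain ⟨v, hv⟩ := exists_joinTime_le hT hd e
  rw [hM] at hv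
  exact ((hmin v).trans hv).antisymm hlow

end BestMeet

/-- among trees of order `n` with diameter `d`, the balanced lever uniquely
minimizes the best meeting time, with the stated values. -/
theorem bestMeet_ge_balancedLever (n d : ℕ) (hd2 : 2 ≤ d) (hdn : d ≤ n - 1)
    {V : Type*} [Fintype V] (G : SimpleGraph V)
    (hT : G.IsTree) (hcard : Fintype.card V = n) (hdiam : gdiam G = d) :
    (Odd d →
      ((d : ℚ)^3 - (d : ℚ))/(6*((n : ℚ) - 1)) + 1/2 ≤ bestMeet G ∧
      (bestMeet G = ((d : ℚ)^3 - (d : ℚ))/(6*((n : ℚ) - 1)) + 1/2 ↔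
        Nonempty (G ≃g balancedLever n d))) ∧
    (Even d →
      ((d : ℚ)^3 - 4*(d : ℚ))/(6*((n : ℚ) - 1)) + 1/2 ≤ bestMeet G ∧
      (bestMeet G = ((d : ℚ)^3 - 4*(d : ℚ))/(6*((n : ℚ) - 1)) + 1/2 ↔
        Nonempty (G ≃g balancedLever n d))) := by
  subst hcard
  have hpos : 0 < Fintype.card V := Fintype.card_pos_iff.2 hT.connected.nonempty
  have hd : d < Fintype.card V := by omega
  exact ⟨fun hodd => bestMeet_bound hT hd2 hd hdiam ((leverExcess_balanced d).1 hodd),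
    fun heven => bestMeet_bound hT hd2 hd hdiam ((leverExcess_balanced d).2 heven)⟩
end

section
/- Let n, d be integers with 2 ≤ d ≤ n−1. For every double broom G of order n with diameter d, J_min(G) ≤ J_min(D_{n,d}), and equality holds if and only if G is isomorphic to the balanced double broom D_{n,d}. -/
open Finset
open scoped Classical

namespace SimpleGraph

section Invariance

variable {V W : Type*} {G : SimpleGraph V} {H : SimpleGraph W}

lemma Iso.dist_apply (e : G ≃g H) (u v : V) : H.dist (e u) (e v) = G.dist u v := by
  have key : Set.range (Walk.length : H.Walk (e u) (e v) → ℕ) =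
      Set.range (Walk.length : G.Walk u v → ℕ) := by
    ext k
    constructor
    · rintro ⟨p, rfl⟩
      exact ⟨(p.map e.symm.toHom).copy (e.symm_apply_apply u) (e.symm_apply_apply v), by simp⟩
    · rintro ⟨p, rfl⟩
      exact ⟨p.map e.toHom, by simp⟩
  rw [dist_eq_sInf, dist_eq_sInf, key]

variable [Fintype V]

lemma Jmin_le [Nonempty V] (w : V) : Jmin G ≤ joinTime G w := by
  rw [Jmin, dif_pos ‹_›]
  exact Finset.inf'_le _ (Finset.mem_univ w)

lemma exists_joinTime_eq_Jmin [Nonempty V] : ∃ w, joinTime G w = Jmin G := by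
  obtain ⟨w, -, hw⟩ := Finset.exists_mem_eq_inf' Finset.univ_nonempty (joinTime G)
  exact ⟨w, by rw [Jmin, dif_pos ‹_›, hw]⟩

variable [Fintype W]

lemma Iso.gdeg_apply (e : G ≃g H) (v : V) : gdeg H (e v) = gdeg G v := by
  refine (Finset.card_equiv e.toEquiv fun u => ?_).symm
  simp [e.map_adj_iff]

lemma Iso.joinTime_apply (e : G ≃g H) (w : V) : joinTime H (e w) = joinTime G w := by
  unfold joinTime hitTime ell
  rw [← e.toEquiv.sum_comp]
  refine Finset.sum_congr rfl fun u _ => ?_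
  rw [← e.toEquiv.sum_comp]
  simp [e.gdeg_apply, e.dist_apply]

lemma Iso.Jmin_eq [Nonempty V] (e : G ≃g H) : Jmin G = Jmin H := by
  have : Nonempty W := ⟨e (Classical.arbitrary V)⟩
  obtain ⟨w, hw⟩ := exists_joinTime_eq_Jmin (G := G)
  obtain ⟨x, hx⟩ := exists_joinTime_eq_Jmin (G := H)
  refine le_antisymm ?_ ?_
  · rw [← hx, ← e.symm.joinTime_apply]
    exact Jmin_le _
  · rw [← hw, ← e.joinTime_apply]
    exact Jmin_le _

end Invariance

section Tree

variable {V : Type*} {G : SimpleGraph V}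

lemma IsTree.eq_of_adj_of_dist_eq (hG : G.IsTree) {u v₁ v₂ w : V}
    (h₁ : G.Adj u v₁) (h₂ : G.Adj u v₂) (hd₁ : G.dist u w = G.dist v₁ w + 1)
    (hd₂ : G.dist u w = G.dist v₂ w + 1) : v₁ = v₂ := by
  obtain ⟨p₁, hp₁⟩ := hG.connected.exists_walk_length_eq_dist v₁ w
  obtain ⟨p₂, hp₂⟩ := hG.connected.exists_walk_length_eq_dist v₂ w
  have hP₁ : (Walk.cons h₁ p₁).IsPath := Walk.isPath_of_length_eq_dist _ (by simp [hp₁, hd₁])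
  have hP₂ : (Walk.cons h₂ p₂).IsPath := Walk.isPath_of_length_eq_dist _ (by simp [hp₂, hd₂])
  have := (hG.existsUnique_path u w).unique hP₁ hP₂
  simpa using congrArg Walk.snd this

lemma Connected.exists_adj_dist_eq (hG : G.Connected) {u w : V} (h : u ≠ w) :
    ∃ v, G.Adj u v ∧ G.dist u w = G.dist v w + 1 := by
  obtain ⟨p, hp⟩ := hG.exists_walk_length_eq_dist u w
  cases p with
  | nil => exact absurd rfl h
  | @cons _ v _ hadj q =>
    refine ⟨v, hadj, le_antisymm ?_ ?_⟩
    · have := hG.dist_triangle (u := u) (v := v) (w := w)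
      rw [dist_eq_one_iff_adj.2 hadj] at this
      omega
    · rw [← hp, Walk.length_cons]
      exact Nat.succ_le_succ (dist_le q)

/-- A function that vanishes at `w`, is `1`-Lipschitz along edges and decreases along some edge out
of every other vertex is the distance to `w`. -/
lemma Connected.dist_eq_of_forall_adj (hG : G.Connected) {w : V} {f : V → ℕ} (hw : f w = 0)
    (hlip : ∀ u v, G.Adj u v → f u ≤ f v + 1)
    (hdec : ∀ u, u ≠ w → ∃ v, G.Adj u v ∧ f u = f v + 1) (u : V) : G.dist u w = f u := by
  refine le_antisymm ?_ ?_
  · induction hk : f u generalizing u with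
    | zero =>
      by_cases h : u = w
      · simp [h]
      · obtain ⟨v, -, hv⟩ := hdec u h
        omega
    | succ k ih =>
      have h : u ≠ w := by rintro rfl; omega
      obtain ⟨v, hadj, hv⟩ := hdec u h
      have := hG.dist_triangle (u := u) (v := v) (w := w)
      rw [dist_eq_one_iff_adj.2 hadj] at this
      have := ih v (by omega)
      omega
  · obtain ⟨p, hp⟩ := hG.exists_walk_length_eq_dist u w
    rw [← hp]
    clear hp
    induction p with
    | nil => simp [hw]
    | cons hadj q ih =>
      have := hlip _ _ hadj
      have := ih hw hdec
      simp only [Walk.length_cons]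
      omega

variable [Fintype V]

lemma IsTree.sum_gdeg_mul (hG : G.IsTree) (w : V) (φ : ℕ → ℚ) :
    ∑ u, (gdeg G u : ℚ) * φ (G.dist u w) =
      ∑ u ∈ univ.erase w, (φ (G.dist u w) + φ (G.dist u w - 1)) := by
  let C : V → V → Prop := fun u v => G.Adj u v ∧ G.dist u w = G.dist v w + 1
  have hC : ∀ u v, (if G.Adj u v then (1 : ℚ) else 0) =
      (if C u v then 1 else 0) + (if C v u then 1 else 0) := by
    intro u v
    by_cases h : G.Adj u v
    · have h3 := hG.dist_eq_dist_add_one_of_adj w h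
      rw [dist_comm, dist_comm (u := w)] at h3
      simp only [C, h, h.symm, true_and, if_true]
      rcases h3 with h3 | h3 <;> rw [h3] <;> simp; all_goals omega
    · have h' : ¬ G.Adj v u := fun h' => h h'.symm
      simp [C, h, h']
  have hdeg : ∀ u, (gdeg G u : ℚ) = ∑ v, if G.Adj u v then (1 : ℚ) else 0 := by
    intro u
    simp [gdeg]
  have hself : ∀ v, ¬ C w v := fun v h => by simpa using h.2
  have hone : ∀ u ∈ univ.erase w, ∑ v, (if C u v then (1 : ℚ) else 0) = 1 := by
    intro u hu
    obtain ⟨v, hv⟩ := hG.connected.exists_adj_dist_eq (Finset.ne_of_mem_erase hu)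
    rw [Finset.sum_eq_single v, if_pos hv]
    · intro x _ hx
      exact if_neg fun hx' => hx (hG.eq_of_adj_of_dist_eq hx'.1 hv.1 hx'.2 hv.2)
    · simp
  calc ∑ u, (gdeg G u : ℚ) * φ (G.dist u w)
      = ∑ u, ∑ v, (if C u v then (1 : ℚ) else 0) * φ (G.dist u w) +
          ∑ u, ∑ v, (if C v u then (1 : ℚ) else 0) * φ (G.dist u w) := by
        simp_rw [hdeg, hC, Finset.sum_mul, add_mul, Finset.sum_add_distrib]
    _ = ∑ u, ∑ v, (if C u v then (1 : ℚ) else 0) * φ (G.dist u w) +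
          ∑ u, ∑ v, (if C u v then (1 : ℚ) else 0) * φ (G.dist u w - 1) := by
        congr 1
        rw [Finset.sum_comm]
        refine Finset.sum_congr rfl fun u _ => Finset.sum_congr rfl fun v _ => ?_
        by_cases h : C u v
        · simp [h, h.2]
        · simp [h]
    _ = ∑ u, (∑ v, if C u v then (1 : ℚ) else 0) * (φ (G.dist u w) + φ (G.dist u w - 1)) := by
        simp_rw [Finset.sum_mul, mul_add, Finset.sum_add_distrib]
    _ = ∑ u ∈ univ.erase w, (φ (G.dist u w) + φ (G.dist u w - 1)) := by
        rw [← Finset.add_sum_erase _ _ (Finset.mem_univ w)]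
        simp only [hself, if_false, Finset.sum_const_zero, zero_mul, zero_add]
        exact Finset.sum_congr rfl fun u hu => by rw [hone u hu, one_mul]

lemma IsTree.sum_gdeg (hG : G.IsTree) :
    ∑ u, (gdeg G u : ℚ) = 2 * (Fintype.card V - 1) := by
  have := hG.connected.nonempty
  have h := hG.sum_gdeg_mul (Classical.arbitrary V) (fun _ => 1)
  have hcard : 1 ≤ Fintype.card V := Fintype.card_pos
  simp only [mul_one, Finset.sum_const, Finset.card_erase_of_mem (Finset.mem_univ _),
    Finset.card_univ, nsmul_eq_mul, Nat.cast_sub hcard, Nat.cast_one] at h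
  rw [h]
  ring

lemma IsTree.sum_gdeg_mul_dist (hG : G.IsTree) (w : V) :
    ∑ u, (gdeg G u : ℚ) * G.dist u w = 2 * ∑ u, (G.dist u w : ℚ) - (Fintype.card V - 1) := by
  rw [hG.sum_gdeg_mul w (fun k => (k : ℚ))]
  have hcard : 1 ≤ Fintype.card V := Fintype.card_pos_iff.2 ⟨w⟩
  have h : ∀ u ∈ univ.erase w, ((G.dist u w : ℚ) + (G.dist u w - 1 : ℕ)) =
      2 * (G.dist u w : ℚ) - 1 := by
    intro u hu
    have := hG.connected.pos_dist_of_ne (Finset.ne_of_mem_erase hu)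
    rw [Nat.cast_sub this]
    push_cast
    ring
  rw [Finset.sum_congr rfl h, Finset.sum_sub_distrib, ← Finset.mul_sum,
    ← Finset.add_sum_erase _ (fun u => (G.dist u w : ℚ)) (Finset.mem_univ w)]
  simp [Finset.card_erase_of_mem, Nat.cast_sub hcard]

/-- On a tree, the joining time to `w` is an increasing affine function of the sum of the distances
to `w`. -/
lemma IsTree.joinTime_eq (hG : G.IsTree) (w : V) :
    joinTime G w = 4 * (Fintype.card V - 1) * ∑ u, (G.dist u w : ℚ) -
      2 * ∑ v, ∑ u, (G.dist u v : ℚ) + (Fintype.card V - 1) := by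
  have hexp : joinTime G w =
      (∑ u, (gdeg G u : ℚ)) * (∑ u, (gdeg G u : ℚ) * G.dist u w) -
        (∑ v, (gdeg G v : ℚ) * ∑ u, (gdeg G u : ℚ) * G.dist u v) / 2 := by
    have h₁ : joinTime G w = ∑ u, ∑ v,
        ((gdeg G v : ℚ) * ((gdeg G u : ℚ) * G.dist u w) / 2 +
          (gdeg G u : ℚ) * ((gdeg G v : ℚ) * G.dist v w) / 2 -
          (gdeg G v : ℚ) * ((gdeg G u : ℚ) * G.dist u v) / 2) := by
      unfold joinTime hitTime ell
      refine Finset.sum_congr rfl fun u _ => ?_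
      rw [Finset.mul_sum]
      refine Finset.sum_congr rfl fun v _ => ?_
      ring
    rw [h₁]
    simp_rw [Finset.sum_sub_distrib, Finset.sum_add_distrib, ← Finset.sum_div]
    rw [Finset.sum_comm (f := fun u v => (gdeg G v : ℚ) * ((gdeg G u : ℚ) * G.dist u v)),
      Finset.sum_comm (f := fun u v => (gdeg G v : ℚ) * ((gdeg G u : ℚ) * G.dist u w))]
    simp_rw [← Finset.mul_sum]
    rw [← Finset.sum_mul]
    ring
  have hswap : ∑ v, (gdeg G v : ℚ) * ∑ u, (G.dist u v : ℚ) =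
      2 * (∑ v, ∑ u, (G.dist u v : ℚ)) - Fintype.card V * (Fintype.card V - 1) := by
    have h : ∀ u, ∑ v, (gdeg G v : ℚ) * G.dist u v =
        2 * ∑ v, (G.dist v u : ℚ) - (Fintype.card V - 1) := by
      intro u
      rw [← hG.sum_gdeg_mul_dist]
      exact Finset.sum_congr rfl fun v _ => by rw [dist_comm]
    rw [Finset.sum_congr rfl fun v _ => Finset.mul_sum _ _ _, Finset.sum_comm,
      Finset.sum_congr rfl fun u _ => h u, Finset.sum_sub_distrib,
      ← Finset.mul_sum]
    simp
    ring
  have hdd : ∑ v, (gdeg G v : ℚ) * ∑ u, (gdeg G u : ℚ) * G.dist u v =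
      4 * (∑ v, ∑ u, (G.dist u v : ℚ)) - 2 * Fintype.card V * (Fintype.card V - 1) -
        2 * (Fintype.card V - 1) ^ 2 := by
    have h : ∀ v, (gdeg G v : ℚ) * ∑ u, (gdeg G u : ℚ) * G.dist u v =
        2 * ((gdeg G v : ℚ) * ∑ u, (G.dist u v : ℚ)) - gdeg G v * (Fintype.card V - 1) := by
      intro v
      rw [hG.sum_gdeg_mul_dist]
      ring
    rw [Finset.sum_congr rfl fun v _ => h v, Finset.sum_sub_distrib, ← Finset.mul_sum,
      ← Finset.sum_mul, hswap, hG.sum_gdeg]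
    ring
  rw [hexp, hG.sum_gdeg, hG.sum_gdeg_mul_dist, hdd]
  ring

end Tree

/-- A graph on `0, …, n` whose edges join each nonzero vertex to a smaller one, its parent, is a
tree. -/
lemma isTree_of_parent {n : ℕ} {G : SimpleGraph (Fin (n + 1))} (p : Fin (n + 1) → Fin (n + 1))
    (hp : ∀ v, v ≠ 0 → p v < v)
    (hadj : ∀ u v, G.Adj u v ↔ (v ≠ 0 ∧ u = p v) ∨ (u ≠ 0 ∧ v = p u)) : G.IsTree := by
  have hreach : ∀ v, G.Reachable v 0 := by
    intro v
    induction v using WellFoundedLT.induction with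
    | ind v ih =>
      by_cases h : v = 0
      · rw [h]
      · exact (Adj.reachable ((hadj _ _).2 (.inr ⟨h, rfl⟩))).trans (ih _ (hp v h))
  have hconn : G.Connected := ⟨fun u v => (hreach u).trans (hreach v).symm⟩
  refine isTree_iff_connected_and_card.2 ⟨hconn, le_antisymm ?_ ?_⟩
  · have hsub : G.edgeSet ⊆ ((univ.erase 0).image fun v => s(v, p v) : Finset _) := by
      intro e
      induction e with
      | h u v =>
        rw [mem_edgeSet, hadj]
        rintro (⟨h, rfl⟩ | ⟨h, rfl⟩)
        · exact Finset.mem_coe.2 (Finset.mem_image.2 ⟨v, by simpa using h, Sym2.eq_swap⟩)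
        · exact Finset.mem_coe.2 (Finset.mem_image.2 ⟨u, by simpa using h, rfl⟩)
    have h₁ := Nat.card_mono (Finset.finite_toSet _) hsub
    rw [Nat.card_coe_set_eq (_ : Set _), Nat.card_coe_set_eq, Set.ncard_coe_finset] at h₁
    have h₂ := Finset.card_image_le (s := (univ : Finset (Fin (n + 1))).erase 0)
      (f := fun v => s(v, p v))
    rw [Finset.card_erase_of_mem (Finset.mem_univ _), Finset.card_univ, Fintype.card_fin] at h₂
    rw [Nat.card_coe_set_eq, Nat.card_eq_fintype_card, Fintype.card_fin]
    omega
  · exact hconn.card_vert_le_card_edgeSet_add_one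

end SimpleGraph

section DoubleBroom

/-- The index on the path `v_0, …, v_d` of vertex `i` of `doubleBroom n d a`, the leaves at `v_1`
being identified with `v_0` and the leaves at `v_{d-1}` with `v_d`. -/
def broomPos (d a i : ℕ) : ℕ :=
  if i ≤ d then i else if i ≤ d + a then 0 else d

/-- The distance in `doubleBroom n d a`. -/
def broomDist (d a i j : ℕ) : ℕ :=
  (broomPos d a i - broomPos d a j) + (broomPos d a j - broomPos d a i) +
    if broomPos d a i = broomPos d a j ∧ i ≠ j then 2 else 0

/-- The parent of vertex `i` of `doubleBroom n d a`, the tree being rooted at `v_0`. -/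
def broomParent (d a i : ℕ) : ℕ :=
  if i ≤ d then i - 1 else if i ≤ d + a then 1 else d - 1

variable {d a s : ℕ}

lemma broomParent_lt (hd : 2 ≤ d) {i : ℕ} (hi : i ≠ 0) : broomParent d a i < i := by
  unfold broomParent
  split_ifs <;> omega

lemma doubleBroom_adj (hd : 2 ≤ d) (u v : Fin (d + s + 1)) :
    (doubleBroom (d + s + 1) d a).Adj u v ↔
      (v.val ≠ 0 ∧ u.val = broomParent d a v) ∨ (u.val ≠ 0 ∧ v.val = broomParent d a u) := by
  rw [doubleBroom, SimpleGraph.fromRel_adj, Ne, Fin.ext_iff]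
  unfold broomParent
  grind

lemma doubleBroom_isTree (hd : 2 ≤ d) : (doubleBroom (d + s + 1) d a).IsTree := by
  refine SimpleGraph.isTree_of_parent
    (fun v => ⟨broomParent d a v, ?_⟩) (fun v hv => ?_) (fun u v => ?_)
  · by_cases h : v.val = 0
    · simp [broomParent, h]
    · exact (broomParent_lt hd h).trans v.isLt
  · exact broomParent_lt hd fun h => hv (Fin.ext h)
  · rw [doubleBroom_adj hd]
    simp only [Ne, Fin.ext_iff, Fin.val_zero]

lemma doubleBroom_dist (hd : 2 ≤ d) (u w : Fin (d + s + 1)) :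
    (doubleBroom (d + s + 1) d a).dist u w = broomDist d a u w := by
  refine (doubleBroom_isTree hd).connected.dist_eq_of_forall_adj (f := fun u => broomDist d a u w)
    ?_ ?_ ?_ u
  · simp [broomDist]
  · intro u v h
    rw [doubleBroom_adj hd] at h
    unfold broomDist broomPos
    unfold broomParent at h
    have := u.isLt
    have := v.isLt
    have := w.isLt
    grind
  · intro u hu
    have hu' : u.val ≠ w.val := fun h => hu (Fin.ext h)
    have hlt := w.isLt
    have hlt' := u.isLt
    suffices h : ∃ v < d + s + 1, ((v ≠ 0 ∧ u.val = broomParent d a v) ∨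
        (u.val ≠ 0 ∧ v = broomParent d a u)) ∧ broomDist d a u w = broomDist d a v w + 1 by
      obtain ⟨v, hv, h⟩ := h
      exact ⟨⟨v, hv⟩, (doubleBroom_adj hd _ _).2 h.1, h.2⟩
    generalize u.val = i at *
    generalize w.val = j at *
    by_cases h₀ : broomPos d a i = 0
    · refine ⟨1, by omega, ?_⟩
      unfold broomDist broomParent
      unfold broomPos at *
      grind
    by_cases h₁ : broomPos d a i = d
    · refine ⟨d - 1, by omega, ?_⟩
      unfold broomDist broomParent
      unfold broomPos at *
      grind
    have hi : i ≤ d := by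
      unfold broomPos at *
      grind
    by_cases h₂ : i + broomDist d a i j = broomPos d a j
    all_goals
      by_cases h₃ : broomDist d a i j = 1
      · refine ⟨j, by omega, ?_⟩
        unfold broomDist broomParent at *
        unfold broomPos at *
        grind
    · refine ⟨i + 1, by unfold broomPos at *; grind, ?_⟩
      unfold broomDist broomParent at *
      unfold broomPos at *
      grind
    · refine ⟨i - 1, by omega, ?_⟩
      unfold broomDist broomParent at *
      unfold broomPos at *
      grind

/-- Reversing the path exchanges the two families of leaves. -/
lemma doubleBroom_nonempty_iso_reverse (hd : 2 ≤ d) (ha : a ≤ s) :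
    Nonempty (doubleBroom (d + s + 1) d a ≃g doubleBroom (d + s + 1) d (s - a)) := by
  let f : Fin (d + s + 1) → Fin (d + s + 1) := fun i =>
    ⟨if i.val ≤ d then d - i else 2 * d + s + 1 - i, by split_ifs <;> omega⟩
  have hf : Function.Involutive f := by
    intro i
    ext
    simp only [f]
    grind
  refine ⟨⟨hf.toPerm, fun {u v} => ?_⟩⟩
  rw [doubleBroom_adj hd, doubleBroom_adj hd]
  simp only [Function.Involutive.coe_toPerm, f, broomParent]
  have := u.isLt
  have := v.isLt
  grind

lemma doubleBroom_two_eq (a b : ℕ) : doubleBroom (2 + s + 1) 2 a = doubleBroom (2 + s + 1) 2 b := by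
  ext u v
  rw [doubleBroom_adj le_rfl, doubleBroom_adj le_rfl]
  simp only [broomParent]
  grind

/-- A sum over the vertices of `doubleBroom (d + s + 1) d a` of a function of the position. -/
lemma sum_broomPos (ha : a ≤ s) (F : ℕ → ℚ) :
    ∑ i : Fin (d + s + 1), F (broomPos d a i) =
      ∑ p ∈ range (d + 1), F p + a * F 0 + (s - a : ℚ) * F d := by
  obtain ⟨b, rfl⟩ := Nat.exists_eq_add_of_le ha
  rw [Fin.sum_univ_eq_sum_range (fun i => F (broomPos d a i)),
    show d + (a + b) + 1 = d + 1 + a + b by ring, Finset.sum_range_add, Finset.sum_range_add]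
  have h₁ : ∀ p ∈ range (d + 1), F (broomPos d a p) = F p := by
    intro p hp
    rw [Finset.mem_range] at hp
    rw [broomPos, if_pos (by omega)]
  have h₂ : ∀ p ∈ range a, F (broomPos d a (d + 1 + p)) = F 0 := by
    intro p hp
    rw [Finset.mem_range] at hp
    rw [broomPos, if_neg (by omega), if_pos (by omega)]
  have h₃ : ∀ p ∈ range b, F (broomPos d a (d + 1 + a + p)) = F d := by
    intro p hp
    rw [broomPos, if_neg (by omega), if_neg (by omega)]
  rw [Finset.sum_congr rfl h₁, Finset.sum_congr rfl h₂, Finset.sum_congr rfl h₃]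
  simp

/-- The sum of the distances to a vertex at position `k` of `doubleBroom (d + s + 1) d a`. -/
def broomTransmission (d s a k : ℕ) : ℚ :=
  (k * (k + 1) + (d - k) * (d - k + 1)) / 2 + a * k + (s - a) * (d - k) +
    2 * ((if k = 0 then (a : ℚ) else 0) + if k = d then (s - a : ℚ) else 0)

lemma sum_range_abs_sub {k : ℕ} (hk : k ≤ d) :
    ∑ p ∈ range (d + 1), |(p : ℚ) - k| = (k * (k + 1) + (d - k) * (d - k + 1)) / 2 := by
  induction d, hk using Nat.le_induction with
  | base =>
    have h : ∀ m : ℕ, ∑ p ∈ range (m + 1), (p : ℚ) = m * (m + 1) / 2 := by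
      intro m
      induction m with
      | zero => simp
      | succ m ih =>
        rw [Finset.sum_range_succ, ih]
        push_cast
        ring
    have h' : ∀ p ∈ range (k + 1), |(p : ℚ) - k| = k - p := by
      intro p hp
      have : (p : ℚ) ≤ k := by exact_mod_cast Nat.le_of_lt_succ (Finset.mem_range.1 hp)
      rw [abs_of_nonpos (by linarith), neg_sub]
    rw [Finset.sum_congr rfl h', Finset.sum_sub_distrib, h]
    simp
    ring
  | succ d hk ih =>
    have : (k : ℚ) ≤ d := by exact_mod_cast hk
    rw [Finset.sum_range_succ, ih, abs_of_nonneg (by push_cast; linarith)]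
    push_cast
    ring

lemma broomPos_le (i : ℕ) : broomPos d a i ≤ d := by
  unfold broomPos
  split_ifs <;> omega

lemma doubleBroom_sum_dist (hd : 2 ≤ d) (ha : a ≤ s) (w : Fin (d + s + 1)) :
    ∑ u, ((doubleBroom (d + s + 1) d a).dist u w : ℚ) =
      broomTransmission d s a (broomPos d a w) := by
  have hle : broomPos d a w ≤ d := broomPos_le _
  have h : ∀ u : Fin (d + s + 1), ((doubleBroom (d + s + 1) d a).dist u w : ℚ) =
      (|(broomPos d a u : ℚ) - broomPos d a w| +
        2 * if broomPos d a u = broomPos d a w then 1 else 0) - 2 * if u = w then 1 else 0 := by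
    intro u
    rw [doubleBroom_dist hd, broomDist]
    push_cast
    have habs : ((broomPos d a u - broomPos d a w : ℕ) : ℚ) +
        ((broomPos d a w - broomPos d a u : ℕ) : ℚ) = |(broomPos d a u : ℚ) - broomPos d a w| := by
      rcases le_total (broomPos d a u) (broomPos d a w) with h | h
      · have h' : (broomPos d a u : ℚ) ≤ broomPos d a w := by exact_mod_cast h
        rw [Nat.sub_eq_zero_of_le h, Nat.cast_sub h, abs_of_nonpos (by linarith)]
        simp
      · have h' : (broomPos d a w : ℚ) ≤ broomPos d a u := by exact_mod_cast h
        rw [Nat.sub_eq_zero_of_le h, Nat.cast_sub h, abs_of_nonneg (by linarith)]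
        simp
    rw [habs, add_sub_assoc]
    congr 1
    by_cases huw : u = w
    · simp [huw]
    · have huw' : u.val ≠ w.val := fun h => huw (Fin.ext h)
      by_cases hp : broomPos d a u = broomPos d a w <;> simp [huw, huw', hp]
  rw [Finset.sum_congr rfl fun u _ => h u, Finset.sum_sub_distrib,
    sum_broomPos ha (fun p => |(p : ℚ) - broomPos d a w| +
      2 * if p = broomPos d a w then 1 else 0)]
  generalize broomPos d a w = k at *
  have hk : (k : ℚ) ≤ d := by exact_mod_cast hle
  rw [Finset.sum_add_distrib, sum_range_abs_sub hle, ← Finset.mul_sum, ← Finset.mul_sum,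
    Finset.sum_ite_eq', Finset.sum_ite_eq', if_pos (Finset.mem_univ _),
    if_pos (Finset.mem_range.2 (by omega)), abs_of_nonneg (sub_nonneg.2 hk),
    abs_of_nonpos (by simp), broomTransmission]
  simp only [eq_comm (a := k), mul_ite, mul_one, mul_zero]
  split_ifs <;> push_cast <;> ring

lemma doubleBroom_joinTime (hd : 2 ≤ d) (ha : a ≤ s) (w : Fin (d + s + 1)) :
    joinTime (doubleBroom (d + s + 1) d a) w =
      4 * (d + s) * broomTransmission d s a (broomPos d a w) -
        2 * (∑ p ∈ range (d + 1), broomTransmission d s a p + a * broomTransmission d s a 0 +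
          (s - a : ℚ) * broomTransmission d s a d) + (d + s) := by
  rw [(doubleBroom_isTree hd).joinTime_eq, Finset.sum_congr rfl fun v _ =>
    doubleBroom_sum_dist hd ha v, sum_broomPos ha, doubleBroom_sum_dist hd ha]
  simp

/-- Moving a leaf from `v_{d-1}` to `v_1` increases the sum of all distances by
`2 * (s - 2 * a - 1) * (d - 2)`. -/
lemma sum_broomTransmission_succ (hd : 2 ≤ d) :
    (∑ p ∈ range (d + 1), broomTransmission d s (a + 1) p +
        (a + 1 : ℕ) * broomTransmission d s (a + 1) 0 +
          (s - (a + 1 : ℕ) : ℚ) * broomTransmission d s (a + 1) d) =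
      (∑ p ∈ range (d + 1), broomTransmission d s a p + a * broomTransmission d s a 0 +
          (s - a : ℚ) * broomTransmission d s a d) + 2 * (s - 2 * a - 1) * (d - 2) := by
  have hd0 : d ≠ 0 := by omega
  have hdiff : ∑ p ∈ range (d + 1), broomTransmission d s (a + 1) p =
      ∑ p ∈ range (d + 1), broomTransmission d s a p := by
    rw [← sub_eq_zero, ← Finset.sum_sub_distrib]
    have hgauss : ∑ p ∈ range (d + 1), (2 * (p : ℚ) - d) = 0 := by
      have h := Finset.sum_range_reflect (fun p => (2 * (p : ℚ) - d)) (d + 1)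
      have h' : ∀ p ∈ range (d + 1), (2 * ((d + 1 - 1 - p : ℕ) : ℚ) - d) = -(2 * (p : ℚ) - d) := by
        intro p hp
        rw [Finset.mem_range] at hp
        rw [Nat.add_sub_cancel, Nat.cast_sub (by omega)]
        ring
      rw [Finset.sum_congr rfl h', Finset.sum_neg_distrib] at h
      linarith
    have h : ∀ p ∈ range (d + 1), broomTransmission d s (a + 1) p - broomTransmission d s a p =
        (2 * (p : ℚ) - d) + ((if p = 0 then 2 else 0) - if p = d then 2 else 0) := by
      intro p _
      unfold broomTransmission
      split_ifs <;> push_cast <;> ring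
    rw [Finset.sum_congr rfl h, Finset.sum_add_distrib, hgauss, Finset.sum_sub_distrib,
      Finset.sum_ite_eq', Finset.sum_ite_eq']
    simp
  rw [hdiff]
  simp only [broomTransmission, if_true, if_neg hd0, if_neg hd0.symm]
  push_cast
  ring

/-- Moving a leaf towards the side with fewer leaves strictly increases `Jmin`. -/
lemma Jmin_doubleBroom_lt_succ (hd : 3 ≤ d) (ha : 2 * (a + 1) ≤ s) :
    Jmin (doubleBroom (d + s + 1) d a) < Jmin (doubleBroom (d + s + 1) d (a + 1)) := by
  obtain ⟨w, hw⟩ := SimpleGraph.exists_joinTime_eq_Jmin (G := doubleBroom (d + s + 1) d (a + 1))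
  rw [← hw]
  have hd3 : (3 : ℚ) ≤ d := by exact_mod_cast hd
  have hs : 2 * ((a : ℚ) + 1) ≤ s := by exact_mod_cast ha
  have ha0 : (0 : ℚ) ≤ a := Nat.cast_nonneg a
  suffices h : ∃ k, 1 ≤ k ∧ k ≤ d - 1 ∧ (d + s) * broomTransmission d s a k <
      (d + s) * broomTransmission d s (a + 1) (broomPos d (a + 1) w) -
        (s - 2 * a - 1) * (d - 2) by
    obtain ⟨k, hk₁, hk₂, hk⟩ := h
    refine (SimpleGraph.Jmin_le ⟨k, by omega⟩).trans_lt ?_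
    have hpos : broomPos d a k = k := by rw [broomPos, if_pos (by omega)]
    rw [doubleBroom_joinTime (by omega) (by omega), doubleBroom_joinTime (by omega) (by omega),
      sum_broomTransmission_succ (by omega), hpos]
    linarith
  have hle : broomPos d (a + 1) w ≤ d := broomPos_le _
  generalize broomPos d (a + 1) w = k at *
  rcases Nat.lt_or_ge k (d - 1) with hk | hk
  · have hkd : k ≠ d := by omega
    have hkd' : k + 1 ≠ d := by omega
    have hT : broomTransmission d s a (k + 1) ≤
        broomTransmission d s (a + 1) k - (s - 2 * a - 1) := by
      simp only [broomTransmission, if_neg hkd, if_neg hkd', if_neg (Nat.succ_ne_zero k)]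
      split_ifs <;> push_cast <;> nlinarith
    refine ⟨k + 1, by omega, by omega, ?_⟩
    nlinarith
  · refine ⟨d - 1, by omega, le_rfl, ?_⟩
    have hd1 : ((d - 1 : ℕ) : ℚ) = d - 1 := by rw [Nat.cast_sub (by omega)]; simp
    have hne : d - 1 ≠ 0 := by omega
    have hne' : d - 1 ≠ d := by omega
    have hne'' : d ≠ 0 := by omega
    have hT : broomTransmission d s a (d - 1) ≤
        broomTransmission d s (a + 1) k - (d - 2) := by
      obtain rfl | rfl : k = d - 1 ∨ k = d := by omega
      · simp only [broomTransmission, if_neg hne, if_neg hne', hd1]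
        push_cast
        linarith
      · simp only [broomTransmission, if_neg hne, if_neg hne', if_neg hne'', if_true, hd1]
        push_cast
        linarith
    nlinarith

lemma Jmin_doubleBroom_lt (hd : 3 ≤ d) {b : ℕ} (hab : a < b) (hb : 2 * b ≤ s) :
    Jmin (doubleBroom (d + s + 1) d a) < Jmin (doubleBroom (d + s + 1) d b) := by
  induction b, hab using Nat.le_induction with
  | base => exact Jmin_doubleBroom_lt_succ hd hb
  | succ b _ ih => exact (ih (by omega)).trans (Jmin_doubleBroom_lt_succ hd hb)

end DoubleBroom

/-- among double brooms of order `n` with diameter `d`, the balanced double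
broom uniquely maximizes `J_min`. -/
theorem Jmin_doubleBroom_le_balanced (n d a : ℕ) (hd2 : 2 ≤ d) (hdn : d ≤ n - 1)
    (ha : a ≤ n - d - 1) :
    Jmin (doubleBroom n d a) ≤ Jmin (balancedDoubleBroom n d) ∧
      (Jmin (doubleBroom n d a) = Jmin (balancedDoubleBroom n d) ↔
        Nonempty (doubleBroom n d a ≃g balancedDoubleBroom n d)) := by
  obtain ⟨s, rfl⟩ : ∃ s, n = d + s + 1 := ⟨n - d - 1, by omega⟩
  rw [balancedDoubleBroom]
  have hs : d + s + 1 - d - 1 = s := by omega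
  rw [hs] at ha ⊢
  suffices h : Jmin (doubleBroom (d + s + 1) d a) < Jmin (doubleBroom (d + s + 1) d (s / 2)) ∨
      Nonempty (doubleBroom (d + s + 1) d a ≃g doubleBroom (d + s + 1) d (s / 2)) by
    rcases h with h | h
    · exact ⟨h.le, fun h' => absurd h' h.ne, fun ⟨e⟩ => e.Jmin_eq⟩
    · exact ⟨h.some.Jmin_eq.le, fun _ => h, fun _ => h.some.Jmin_eq⟩
  obtain rfl | hd3 : d = 2 ∨ 3 ≤ d := by omega
  · rw [doubleBroom_two_eq a (s / 2)]
    exact .inr ⟨.refl⟩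
  have hsmall : ∀ b, 2 * b ≤ s →
      Jmin (doubleBroom (d + s + 1) d b) < Jmin (doubleBroom (d + s + 1) d (s / 2)) ∨
        Nonempty (doubleBroom (d + s + 1) d b ≃g doubleBroom (d + s + 1) d (s / 2)) := by
    intro b hb
    obtain rfl | hlt : b = s / 2 ∨ b < s / 2 := by omega
    · exact .inr ⟨.refl⟩
    · exact .inl (Jmin_doubleBroom_lt hd3 hlt (by omega))
  rcases Nat.le_total (2 * a) s with h | h
  · exact hsmall a h
  · obtain ⟨e⟩ := doubleBroom_nonempty_iso_reverse hd2 ha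
    rw [e.Jmin_eq]
    exact (hsmall (s - a) (by omega)).imp_right fun ⟨e'⟩ => ⟨e.trans e'⟩
end
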